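/- arXiv:1704.07873 — 10 statements merged into one kernel-verified Lean document; each statement's English description precedes it below -/
import Mathlib

section
/- Let μ and ν be finite Borel measures on ℝ, let c_f, c_g ∈ ℝ, and define f, g : ℝ → ℝ by f(x) = c_f + μ((−∞, x]) and g(x) = c_g + ν((−∞, x]) (so f and g are bounded, nondecreasing and right-continuous). Then ∫ f dν + ∫ g dμ = (c_f + μ(ℝ))·(c_g + ν(ℝ)) − c_f·c_g + ∫∫ 1{x = y} dμ(x) dν(y). -/
open MeasureTheory Filter Topology Set Function

theorem aux_meas (μ : Measure ℝ) : Measurable (fun y => μ (Set.Iic y)) :=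
  Monotone.measurable (fun _ _ h => measure_mono (Set.Iic_subset_Iic.2 h))

theorem aux_int (μ ν : Measure ℝ) [IsFiniteMeasure μ] [IsFiniteMeasure ν] (c : ℝ) :
    (∫ y, (c + (μ (Set.Iic y)).toReal) ∂ν)
      = c * (ν Set.univ).toReal + (∫⁻ y, μ (Set.Iic y) ∂ν).toReal := by
  have hlt : (∫⁻ y, μ (Set.Iic y) ∂ν) ≠ ⊤ := by
    refine ne_top_of_le_ne_top ?_ (lintegral_mono (fun y => measure_mono (Set.subset_univ (Set.Iic y))))
    rw [lintegral_const]
    exact ENNReal.mul_ne_top (measure_ne_top _ _) (measure_ne_top _ _)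
  have hi := integrable_toReal_of_lintegral_ne_top (aux_meas μ).aemeasurable hlt
  rw [integral_add (integrable_const _) hi,
    integral_toReal (aux_meas μ).aemeasurable (Eventually.of_forall fun y => measure_lt_top _ _)]
  simp [Measure.real, mul_comm]

/-- **Integration by parts (Lemma A, monotone case).**
If `f x = c_f + μ(-∞,x]` and `g x = c_g + ν(-∞,x]` for finite Borel measures `μ, ν` on `ℝ`,
then `∫ f dν + ∫ g dμ = (c_f + μ(ℝ))(c_g + ν(ℝ)) - c_f c_g + ∫∫ 1{x=y} dμ dν`. -/
theorem integration_by_parts_monotone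
    (μ ν : Measure ℝ) [IsFiniteMeasure μ] [IsFiniteMeasure ν] (cf cg : ℝ)
    (f g : ℝ → ℝ)
    (hf : ∀ x, f x = cf + (μ (Set.Iic x)).toReal)
    (hg : ∀ x, g x = cg + (ν (Set.Iic x)).toReal) :
    (∫ y, f y ∂ν) + (∫ x, g x ∂μ)
      = (cf + (μ Set.univ).toReal) * (cg + (ν Set.univ).toReal) - cf * cg
        + ∫ p : ℝ × ℝ,
            Set.indicator {q : ℝ × ℝ | q.1 = q.2} (fun _ => (1 : ℝ)) p ∂(μ.prod ν) := by
  simp_rw [hf, hg]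
  rw [aux_int, aux_int]
  have hA : MeasurableSet {q : ℝ × ℝ | q.1 ≤ q.2} := measurableSet_le measurable_fst measurable_snd
  have hB : MeasurableSet {q : ℝ × ℝ | q.2 ≤ q.1} := measurableSet_le measurable_snd measurable_fst
  have hD : MeasurableSet {q : ℝ × ℝ | q.1 = q.2} := measurableSet_eq_fun measurable_fst measurable_snd
  have h1 : (∫⁻ y, μ (Set.Iic y) ∂ν) = (μ.prod ν) {q : ℝ × ℝ | q.1 ≤ q.2} := by
    rw [Measure.prod_apply_symm hA]; rfl
  have h2 : (∫⁻ y, ν (Set.Iic y) ∂μ) = (μ.prod ν) {q : ℝ × ℝ | q.2 ≤ q.1} := by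
    rw [Measure.prod_apply hB]; rfl
  have h3 := measureReal_union_add_inter (μ := μ.prod ν) (s := {q : ℝ × ℝ | q.1 ≤ q.2}) hB
  have hU : {q : ℝ × ℝ | q.1 ≤ q.2} ∪ {q : ℝ × ℝ | q.2 ≤ q.1} = Set.univ ×ˢ Set.univ := by
    ext q; simp [le_total]
  have hI : {q : ℝ × ℝ | q.1 ≤ q.2} ∩ {q : ℝ × ℝ | q.2 ≤ q.1} = {q : ℝ × ℝ | q.1 = q.2} := by
    ext q; simp [le_antisymm_iff]
  rw [hU, hI, measureReal_prod_prod] at h3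
  rw [h1, h2, integral_indicator_const _ hD]
  simp only [Measure.real, smul_eq_mul, mul_one] at h3 ⊢
  linarith
end

section
/- Let μ₁, μ₂, ν₁, ν₂ be finite Borel measures on ℝ with ν₁(ℝ) = ν₂(ℝ). Let c_f ∈ ℝ and define f(x) = c_f + μ₁((−∞, x]) − μ₂((−∞, x]) and g(x) = ν₁((−∞, x]) − ν₂((−∞, x]); thus f and g are right-continuous of bounded variation and g(x) → 0 as x → ±∞. Then, writing ∫ h d(ρ₁ − ρ₂) := ∫ h dρ₁ − ∫ h dρ₂ for finite measures ρ₁, ρ₂ and expanding the double integral by bilinearity, ∫ f d(ν₁ − ν₂) + ∫ g d(μ₁ − μ₂) = ∫∫ 1{x = y} d(μ₁ − μ₂)(x) d(ν₁ − ν₂)(y). -/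
open MeasureTheory Filter Topology Set Function

/-- The double integral `∫∫ 1{x = y} dμ(x) dν(y)` of the indicator of the diagonal
with respect to the product measure `μ × ν`. -/
noncomputable def diagInt (μ ν : MeasureTheory.Measure ℝ) : ℝ :=
  ∫ p : ℝ × ℝ, Set.indicator {q : ℝ × ℝ | q.1 = q.2} (fun _ => (1 : ℝ)) p ∂(μ.prod ν)

theorem ibp_aux_int (μ ν : Measure ℝ) [IsFiniteMeasure μ] [IsFiniteMeasure ν] :
    Integrable (fun y => (μ (Set.Iic y)).toReal) ν := by
  have hm : Monotone (fun y => (μ (Set.Iic y)).toReal) := fun a b hab =>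
    ENNReal.toReal_mono (measure_ne_top _ _) (measure_mono (Set.Iic_subset_Iic.2 hab))
  refine Integrable.of_bound (C := (μ Set.univ).toReal) hm.measurable.aestronglyMeasurable ?_
  refine Eventually.of_forall fun y => ?_
  rw [Real.norm_of_nonneg ENNReal.toReal_nonneg]
  exact ENNReal.toReal_mono (measure_ne_top _ _) (measure_mono (Set.subset_univ _))

theorem ibp_aux (μ ν : Measure ℝ) [IsFiniteMeasure μ] [IsFiniteMeasure ν] :
    (∫ y, (μ (Set.Iic y)).toReal ∂ν) + (∫ x, (ν (Set.Iic x)).toReal ∂μ)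
      = (μ Set.univ).toReal * (ν Set.univ).toReal + diagInt μ ν := by
  have hA : MeasurableSet {p : ℝ × ℝ | p.1 ≤ p.2} := measurableSet_le measurable_fst measurable_snd
  have hB : MeasurableSet {p : ℝ × ℝ | p.2 ≤ p.1} := measurableSet_le measurable_snd measurable_fst
  have hD : MeasurableSet {p : ℝ × ℝ | p.1 = p.2} :=
    measurableSet_eq_fun measurable_fst measurable_snd
  have h1 : (∫ y, (μ (Set.Iic y)).toReal ∂ν) = (μ.prod ν).real {p : ℝ × ℝ | p.1 ≤ p.2} := by
    rw [measureReal_def, Measure.prod_apply_symm hA]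
    rw [integral_toReal]
    · rfl
    · exact (measurable_measure_prodMk_right hA).aemeasurable
    · exact Eventually.of_forall fun y => measure_lt_top _ _
  have h2 : (∫ x, (ν (Set.Iic x)).toReal ∂μ) = (μ.prod ν).real {p : ℝ × ℝ | p.2 ≤ p.1} := by
    rw [measureReal_def, Measure.prod_apply hB]
    rw [integral_toReal]
    · rfl
    · exact (measurable_measure_prodMk_left hB).aemeasurable
    · exact Eventually.of_forall fun y => measure_lt_top _ _
  have h3 : diagInt μ ν = (μ.prod ν).real {p : ℝ × ℝ | p.1 = p.2} := by
    unfold diagInt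
    exact integral_indicator_one hD
  have hU : {p : ℝ × ℝ | p.1 ≤ p.2} ∪ {p : ℝ × ℝ | p.2 ≤ p.1} = Set.univ ×ˢ Set.univ := by
    ext p
    simp [le_total]
  have hI : {p : ℝ × ℝ | p.1 ≤ p.2} ∩ {p : ℝ × ℝ | p.2 ≤ p.1} = {p : ℝ × ℝ | p.1 = p.2} := by
    ext p
    simp [le_antisymm_iff]
  have h4 := measureReal_union_add_inter (μ := μ.prod ν) (s := {p : ℝ × ℝ | p.1 ≤ p.2}) hB
  rw [hU, hI, measureReal_prod_prod] at h4
  rw [h1, h2, h3, ← h4]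
  rfl

/-- **Integration by parts (Lemma A, second clause).**
If `f x = c_f + μ₁(-∞,x] - μ₂(-∞,x]` and `g x = ν₁(-∞,x] - ν₂(-∞,x]` with `ν₁(ℝ) = ν₂(ℝ)`
(so that `g` vanishes at `±∞`), then
`∫ f d(ν₁ - ν₂) + ∫ g d(μ₁ - μ₂) = ∫∫ 1{x=y} d(μ₁-μ₂) d(ν₁-ν₂)`,
all signed integrals being understood as differences. -/
theorem integration_by_parts_signed
    (μ₁ μ₂ ν₁ ν₂ : Measure ℝ)
    [IsFiniteMeasure μ₁] [IsFiniteMeasure μ₂] [IsFiniteMeasure ν₁] [IsFiniteMeasure ν₂]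
    (hν : ν₁ Set.univ = ν₂ Set.univ) (cf : ℝ)
    (f g : ℝ → ℝ)
    (hf : ∀ x, f x = cf + (μ₁ (Set.Iic x)).toReal - (μ₂ (Set.Iic x)).toReal)
    (hg : ∀ x, g x = (ν₁ (Set.Iic x)).toReal - (ν₂ (Set.Iic x)).toReal) :
    ((∫ y, f y ∂ν₁) - (∫ y, f y ∂ν₂)) + ((∫ x, g x ∂μ₁) - (∫ x, g x ∂μ₂))
      = diagInt μ₁ ν₁ - diagInt μ₁ ν₂ - diagInt μ₂ ν₁ + diagInt μ₂ ν₂ := by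
  have e1 : ∀ ν : Measure ℝ, IsFiniteMeasure ν → (∫ y, f y ∂ν) = cf * (ν Set.univ).toReal
      + (∫ y, (μ₁ (Set.Iic y)).toReal ∂ν) - (∫ y, (μ₂ (Set.Iic y)).toReal ∂ν) := by
    intro ν _
    simp_rw [hf]
    have hi : Integrable (fun y => cf + (μ₁ (Set.Iic y)).toReal) ν :=
      (integrable_const _).add (ibp_aux_int μ₁ ν)
    rw [integral_sub hi (ibp_aux_int μ₂ ν),
      integral_add (integrable_const _) (ibp_aux_int μ₁ ν)]
    simp [measureReal_def, mul_comm]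
  have e2 : ∀ μ : Measure ℝ, IsFiniteMeasure μ → (∫ y, g y ∂μ) =
      (∫ y, (ν₁ (Set.Iic y)).toReal ∂μ) - (∫ y, (ν₂ (Set.Iic y)).toReal ∂μ) := by
    intro μ _
    simp_rw [hg]
    rw [integral_sub (ibp_aux_int ν₁ μ) (ibp_aux_int ν₂ μ)]
  rw [e1 ν₁ inferInstance, e1 ν₂ inferInstance, e2 μ₁ inferInstance, e2 μ₂ inferInstance]
  have a := ibp_aux μ₁ ν₁
  have b := ibp_aux μ₁ ν₂
  have c := ibp_aux μ₂ ν₁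
  have d := ibp_aux μ₂ ν₂
  rw [hν] at a c ⊢
  linarith
end

section
/- Let μ and ν be finite Borel measures on ℝ. Then ∫∫ 1{x = y} dμ(x) dν(y) = ∑'_{x ∈ ℝ} μ({x})·ν({x}), where the sum on the right is the tsum over all x ∈ ℝ of the product of the point masses (only countably many terms are nonzero). -/
open MeasureTheory Filter Topology Set Function

/-- **Diagonal term as a sum over common atoms.** For finite Borel measures `μ, ν` on `ℝ`,
`∫∫ 1{x = y} dμ(x) dν(y) = ∑'_{x ∈ ℝ} μ({x})·ν({x})`. -/
theorem diag_integral_eq_tsum_atoms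
    (μ ν : Measure ℝ) [IsFiniteMeasure μ] [IsFiniteMeasure ν] :
    (∫ p : ℝ × ℝ, Set.indicator {q : ℝ × ℝ | q.1 = q.2} (fun _ => (1 : ℝ)) p ∂(μ.prod ν))
      = ∑' x : ℝ, (μ {x}).toReal * (ν {x}).toReal := by
  have hD : MeasurableSet {q : ℝ × ℝ | q.1 = q.2} :=
    measurableSet_eq_fun measurable_fst measurable_snd
  have hS : {x : ℝ | 0 < ν {x}}.Countable :=
    Measure.countable_meas_pos_of_disjoint_iUnion (μ := ν) (As := fun x : ℝ => {x})
      (fun x => measurableSet_singleton x)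
      (fun x y h => by simpa [Function.onFun] using h)
  have key : (μ.prod ν) {q : ℝ × ℝ | q.1 = q.2} = ∑' x : ℝ, μ {x} * ν {x} := by
    rw [Measure.prod_apply hD]
    have h1 : ∀ x : ℝ, Prod.mk x ⁻¹' {q : ℝ × ℝ | q.1 = q.2} = {x} := by
      intro x; ext y; simp [eq_comm]
    simp_rw [h1]
    have h2 : ∫⁻ x, ν {x} ∂μ = ∫⁻ x in {x : ℝ | 0 < ν {x}}, ν {x} ∂μ := by
      rw [← lintegral_indicator hS.measurableSet]
      congr 1
      ext x
      by_cases h : 0 < ν {x}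
      · rw [Set.indicator_of_mem (by exact h)]
      · rw [Set.indicator_of_notMem (by exact h)]
        simpa using h
    rw [h2, lintegral_countable _ hS]
    rw [tsum_subtype {x : ℝ | 0 < ν {x}} (fun x => ν {x} * μ {x})]
    congr 1
    ext x
    by_cases h : 0 < ν {x}
    · rw [Set.indicator_of_mem (by exact h), mul_comm]
    · rw [Set.indicator_of_notMem (by exact h)]
      have : ν {x} = 0 := by simpa using h
      simp [this]
  rw [integral_indicator_const _ hD, measureReal_def, key, ENNReal.tsum_toReal_eq
    (fun x => ENNReal.mul_ne_top (measure_ne_top _ _) (measure_ne_top _ _))]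
  simp [ENNReal.toReal_mul]
end

section
/- Let g : ℝ → ℝ be right-continuous of bounded variation, with signed Lebesgue–Stieltjes measure given by g(x) − g(x') = ν₁((x', x]) − ν₂((x', x]) for finite Borel measures ν₁, ν₂. Let Z : ℝ → ℝ be right-continuous of bounded variation with Z(t) → 0 as t → ±∞, with signed Lebesgue–Stieltjes measure given similarly by finite Borel measures ζ₁, ζ₂ (so ζ₁(ℝ) = ζ₂(ℝ)). Then ∫ g dZ = −∫ Z dg + ∑'_{x ∈ ℝ} (g(x) − g(x⁻))·(Z(x) − Z(x⁻)), where ∫ g dZ := ∫ g dζ₁ − ∫ g dζ₂, ∫ Z dg := ∫ Z dν₁ − ∫ Z dν₂, and the sum is the (absolutely convergent) tsum over all x ∈ ℝ of the products of jumps (only countably many terms are nonzero). -/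
open MeasureTheory Filter Topology Set Function

lemma aux_int_of_mono (F : ℝ → ℝ) (hF : Measurable F) (C : ℝ) (hb : ∀ x, 0 ≤ F x ∧ F x ≤ C)
    (μ : Measure ℝ) [IsFiniteMeasure μ] : Integrable F μ := by
  refine Integrable.of_bound hF.aestronglyMeasurable C (Eventually.of_forall fun x => ?_)
  rw [Real.norm_eq_abs, abs_of_nonneg (hb x).1]
  exact (hb x).2

lemma aux_meas_Iic (ζ : Measure ℝ) [IsFiniteMeasure ζ] : Measurable fun x => ζ.real (Iic x) := by
  apply Monotone.measurable
  intro a b hab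
  exact measureReal_mono (Iic_subset_Iic.2 hab)

lemma aux_meas_Iio (ζ : Measure ℝ) [IsFiniteMeasure ζ] : Measurable fun x => ζ.real (Iio x) := by
  apply Monotone.measurable
  intro a b hab
  exact measureReal_mono (Iio_subset_Iio hab)

lemma aux_singleton (ζ : Measure ℝ) [IsFiniteMeasure ζ] (x : ℝ) :
    ζ.real (Iic x) = ζ.real (Iio x) + ζ.real {x} := by
  rw [← measureReal_union (by simp) (measurableSet_singleton x), Iio_union_right]

lemma aux_Ici (ζ : Measure ℝ) [IsFiniteMeasure ζ] (x : ℝ) :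
    ζ.real (Ici x) = ζ.real univ - ζ.real (Iic x) + ζ.real {x} := by
  have h : ζ.real (Iio x) + ζ.real (Ici x) = ζ.real univ := by
    rw [← measureReal_union (by
      rw [Set.disjoint_left]; intro y h1 h2; exact not_lt.2 (mem_Ici.1 h2) (mem_Iio.1 h1)) measurableSet_Ici,
      Iio_union_Ici]
  rw [aux_singleton]; linarith

lemma aux_int_Iic (ζ μ : Measure ℝ) [IsFiniteMeasure ζ] [IsFiniteMeasure μ] :
    Integrable (fun x => ζ.real (Iic x)) μ :=
  aux_int_of_mono _ (aux_meas_Iic ζ) (ζ.real univ)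
    (fun _ => ⟨measureReal_nonneg, measureReal_mono (subset_univ _)⟩) μ

lemma aux_int_sing (ζ μ : Measure ℝ) [IsFiniteMeasure ζ] [IsFiniteMeasure μ] :
    Integrable (fun x => ζ.real {x}) μ := by
  refine aux_int_of_mono _ ?_ (ζ.real univ)
    (fun _ => ⟨measureReal_nonneg, measureReal_mono (subset_univ _)⟩) μ
  have : (fun x => ζ.real {x}) = fun x => ζ.real (Iic x) - ζ.real (Iio x) := by
    ext x; rw [aux_singleton]; ring
  rw [this]
  exact (aux_meas_Iic ζ).sub (aux_meas_Iio ζ)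

lemma aux_summable (ν ζ : Measure ℝ) [IsFiniteMeasure ν] [IsFiniteMeasure ζ] :
    Summable fun x : ℝ => ν.real {x} * ζ.real {x} := by
  have h : Summable fun x : ℝ => ν.real {x} := by
    refine summable_of_sum_le (c := ν.real univ) (fun x => measureReal_nonneg) (fun u => ?_)
    rw [sum_measureReal_singleton]
    exact measureReal_mono (subset_univ _)
  refine Summable.of_nonneg_of_le (fun x => mul_nonneg measureReal_nonneg measureReal_nonneg)
    (fun x => ?_) (h.mul_right (ζ.real univ))
  exact mul_le_mul_of_nonneg_left (measureReal_mono (subset_univ _)) measureReal_nonneg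

lemma aux_atoms (ν ζ : Measure ℝ) [IsFiniteMeasure ν] [IsFiniteMeasure ζ] :
    ∫ y, ζ.real {y} ∂ν = ∑' y : ℝ, ν.real {y} * ζ.real {y} := by
  have hc : {y : ℝ | 0 < ζ {y}}.Countable := by
    apply Measure.countable_meas_pos_of_disjoint_iUnion (fun i => measurableSet_singleton i)
    intro a b hab
    simpa [Function.onFun] using hab
  have hz : ∀ x, x ∉ {y : ℝ | 0 < ζ {y}} → ζ.real {x} = 0 := by
    intro x hx
    have : ζ {x} = 0 := by simpa using hx
    simp [measureReal_def, this]
  rw [← setIntegral_eq_integral_of_forall_compl_eq_zero hz,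
    setIntegral_countable _ hc (aux_int_sing ζ ν).integrableOn]
  simp only [smul_eq_mul]
  rw [tsum_subtype {y : ℝ | 0 < ζ {y}} (fun y => ν.real {y} * ζ.real {y})]
  congr 1
  ext x
  by_cases hx : x ∈ {y : ℝ | 0 < ζ {y}}
  · rw [indicator_of_mem hx]
  · rw [indicator_of_notMem hx, hz x hx, mul_zero]

lemma aux_fubini (ν ζ : Measure ℝ) [IsFiniteMeasure ν] [IsFiniteMeasure ζ] :
    ∫ x, ν.real (Iic x) ∂ζ = ∫ y, ζ.real (Ici y) ∂ν := by
  have hm : MeasurableSet {p : ℝ × ℝ | p.2 ≤ p.1} := measurableSet_le measurable_snd measurable_fst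
  have h := integral_integral_swap (μ := ζ) (ν := ν)
    (f := fun x y => ({p : ℝ × ℝ | p.2 ≤ p.1}.indicator (fun _ => (1:ℝ)) (x, y)))
    ((integrable_const (1:ℝ)).indicator hm)
  have h1 : ∀ x, ∫ y, ({p : ℝ × ℝ | p.2 ≤ p.1}.indicator (fun _ => (1:ℝ)) (x, y)) ∂ν
      = ν.real (Iic x) := fun x => by
    rw [← integral_indicator_one measurableSet_Iic]; rfl
  have h2 : ∀ y, ∫ x, ({p : ℝ × ℝ | p.2 ≤ p.1}.indicator (fun _ => (1:ℝ)) (x, y)) ∂ζ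
      = ζ.real (Ici y) := fun y => by
    rw [← integral_indicator_one measurableSet_Ici]; rfl
  simpa only [h1, h2] using h

lemma aux_parts (ν ζ : Measure ℝ) [IsFiniteMeasure ν] [IsFiniteMeasure ζ] :
    ∫ x, ν.real (Iic x) ∂ζ = ν.real univ * ζ.real univ - ∫ y, ζ.real (Iic y) ∂ν
      + ∑' y : ℝ, ν.real {y} * ζ.real {y} := by
  rw [aux_fubini, ← aux_atoms]
  simp_rw [aux_Ici ζ]
  have hi : Integrable (fun y => ζ.real univ - ζ.real (Iic y)) ν :=
    (integrable_const _).sub (aux_int_Iic ζ ν)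
  rw [integral_add hi (aux_int_sing ζ ν),
    integral_sub (integrable_const _) (aux_int_Iic ζ ν)]
  simp

lemma aux_left (ν : Measure ℝ) [IsFiniteMeasure ν] (x : ℝ) :
    Tendsto (fun y => ν.real (Iic y)) (𝓝[<] x) (𝓝 (ν.real (Iio x))) := by
  refine (ENNReal.tendsto_toReal (measure_ne_top ν _)).comp
    (tendsto_measure_of_tendsto_indicator_of_isFiniteMeasure _ ν (fun _ => measurableSet_Iic) ?_)
  intro z
  by_cases hz : z < x
  · filter_upwards [Ioo_mem_nhdsLT hz] with y hy
    simp [hz, hy.1.le]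
  · filter_upwards [self_mem_nhdsWithin] with y hy
    have : y < z := lt_of_lt_of_le hy (not_lt.1 hz)
    simp [hz, this]

lemma aux_bot (ν : Measure ℝ) [IsFiniteMeasure ν] :
    Tendsto (fun y => ν.real (Iic y)) atBot (𝓝 0) := by
  have h : Tendsto (fun y => ν (Iic y)) atBot (𝓝 (ν ∅)) := by
    refine tendsto_measure_of_tendsto_indicator_of_isFiniteMeasure _ ν
      (fun _ => measurableSet_Iic) ?_
    intro z
    filter_upwards [eventually_lt_atBot z] with y hy
    simp [hy]
  have h2 := (ENNReal.tendsto_toReal (measure_ne_top ν _)).comp h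
  rw [measure_empty, ENNReal.toReal_zero] at h2
  exact h2

lemma aux_top (ν : Measure ℝ) [IsFiniteMeasure ν] :
    Tendsto (fun y => ν.real (Iic y)) atTop (𝓝 (ν.real univ)) :=
  (ENNReal.tendsto_toReal (measure_ne_top ν _)).comp (tendsto_measure_Iic_atTop ν)

lemma aux_Ioc (ν : Measure ℝ) [IsFiniteMeasure ν] {a b : ℝ} (h : a ≤ b) :
    (ν (Ioc a b)).toReal = ν.real (Iic b) - ν.real (Iic a) := by
  rw [← measureReal_def, ← Iic_union_Ioc_eq_Iic h,
    measureReal_union (Iic_disjoint_Ioc le_rfl) measurableSet_Ioc]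
  ring

lemma aux_repr (g : ℝ → ℝ) (ν₁ ν₂ : Measure ℝ) [IsFiniteMeasure ν₁] [IsFiniteMeasure ν₂]
    (hgm : ∀ x' x : ℝ, x' ≤ x →
      g x - g x' = (ν₁ (Set.Ioc x' x)).toReal - (ν₂ (Set.Ioc x' x)).toReal) :
    ∃ c, g = fun x => c + (ν₁.real (Iic x) - ν₂.real (Iic x)) := by
  refine ⟨g 0 - (ν₁.real (Iic 0) - ν₂.real (Iic 0)), funext fun x => ?_⟩
  rcases le_total x 0 with h | h
  all_goals
    have := hgm _ _ h
    rw [aux_Ioc _ h, aux_Ioc _ h] at this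
    linarith

lemma aux_jump (c : ℝ) (ν₁ ν₂ : Measure ℝ) [IsFiniteMeasure ν₁] [IsFiniteMeasure ν₂] (x : ℝ) :
    (c + (ν₁.real (Iic x) - ν₂.real (Iic x)))
      - leftLim (fun x => c + (ν₁.real (Iic x) - ν₂.real (Iic x))) x
      = ν₁.real {x} - ν₂.real {x} := by
  rw [leftLim_eq_of_tendsto (((aux_left ν₁ x).sub (aux_left ν₂ x)).const_add c),
    aux_singleton ν₁, aux_singleton ν₂]
  ring

/-- **Lemma 9 decomposition: `∫ g dZ = T₁(Z) + T₂(Z)`.**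
Let `g` be right-continuous of bounded variation with signed Lebesgue–Stieltjes measure
`ν₁ - ν₂`, and let `Z` be right-continuous of bounded variation vanishing at `±∞` with signed
Lebesgue–Stieltjes measure `ζ₁ - ζ₂`. Then
`∫ g dZ = -∫ Z dg + ∑'_{x} (g(x) - g(x⁻))·(Z(x) - Z(x⁻))`. -/
theorem integral_bv_decomposition
    (g Z : ℝ → ℝ) (ν₁ ν₂ ζ₁ ζ₂ : Measure ℝ)
    [IsFiniteMeasure ν₁] [IsFiniteMeasure ν₂] [IsFiniteMeasure ζ₁] [IsFiniteMeasure ζ₂]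
    (hg_rc : ∀ x, ContinuousWithinAt g (Set.Ici x) x)
    (hgm : ∀ x' x : ℝ, x' ≤ x →
      g x - g x' = (ν₁ (Set.Ioc x' x)).toReal - (ν₂ (Set.Ioc x' x)).toReal)
    (hZ_rc : ∀ x, ContinuousWithinAt Z (Set.Ici x) x)
    (hZm : ∀ x' x : ℝ, x' ≤ x →
      Z x - Z x' = (ζ₁ (Set.Ioc x' x)).toReal - (ζ₂ (Set.Ioc x' x)).toReal)
    (hZbot : Tendsto Z atBot (nhds 0)) (hZtop : Tendsto Z atTop (nhds 0)) :
    (∫ x, g x ∂ζ₁) - (∫ x, g x ∂ζ₂)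
      = -((∫ x, Z x ∂ν₁) - (∫ x, Z x ∂ν₂))
        + ∑' x : ℝ, (g x - Function.leftLim g x) * (Z x - Function.leftLim Z x) := by
  obtain ⟨c, rfl⟩ := aux_repr g ν₁ ν₂ hgm
  obtain ⟨d, rfl⟩ := aux_repr Z ζ₁ ζ₂ hZm
  have hd : d = 0 := by
    have := tendsto_nhds_unique hZbot (((aux_bot ζ₁).sub (aux_bot ζ₂)).const_add d)
    linarith
  have hu : ζ₁.real univ = ζ₂.real univ := by
    have := tendsto_nhds_unique hZtop (((aux_top ζ₁).sub (aux_top ζ₂)).const_add d)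
    linarith
  have hI : ∀ (e : ℝ) (α β μ : Measure ℝ) [IsFiniteMeasure α] [IsFiniteMeasure β]
      [IsFiniteMeasure μ], ∫ x, (e + (α.real (Iic x) - β.real (Iic x))) ∂μ
        = μ.real univ * e + (∫ x, α.real (Iic x) ∂μ - ∫ x, β.real (Iic x) ∂μ) := by
    intro e α β μ _ _ _
    have hi : Integrable (fun x => α.real (Iic x) - β.real (Iic x)) μ :=
      (aux_int_Iic α μ).sub (aux_int_Iic β μ)
    rw [integral_add (integrable_const _) hi,
      integral_sub (aux_int_Iic α μ) (aux_int_Iic β μ)]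
    simp
  have hS : ∑' x : ℝ, (ν₁.real {x} - ν₂.real {x}) * (ζ₁.real {x} - ζ₂.real {x})
      = (∑' x : ℝ, ν₁.real {x} * ζ₁.real {x} - ∑' x : ℝ, ν₁.real {x} * ζ₂.real {x})
        - (∑' x : ℝ, ν₂.real {x} * ζ₁.real {x} - ∑' x : ℝ, ν₂.real {x} * ζ₂.real {x}) := by
    have s1 := aux_summable ν₁ ζ₁
    have s2 := aux_summable ν₁ ζ₂
    have s3 := aux_summable ν₂ ζ₁
    have s4 := aux_summable ν₂ ζ₂
    rw [← s1.tsum_sub s2, ← s3.tsum_sub s4, ← (s1.sub s2).tsum_sub (s3.sub s4)]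
    congr 1
    ext x
    ring
  simp only [aux_jump]
  rw [hS, hI, hI, hI, hI, aux_parts ν₁ ζ₁, aux_parts ν₁ ζ₂, aux_parts ν₂ ζ₁, aux_parts ν₂ ζ₂,
    hd, hu]
  ring
end

section
/- Let x₁, …, x_n ∈ ℝ, let F₀ be a distribution function with Lebesgue–Stieltjes probability measure μ₀, and define the signed empirical measure ζ := n^{−1/2}·(∑_{i=1}^n δ_{x_i} − n·μ₀) (a difference of two finite Borel measures), with 'distribution function' G(t) := ζ((−∞,t]) = n^{−1/2} ∑_{i=1}^n (1{x_i ≤ t} − F₀(t)). Let g : ℝ → ℝ be a bounded Borel function of finite total variation ‖g‖_TV, and let ḡ be its right-continuous version, ḡ(x) := lim_{y ↓ x} g(y). Then |∫ g dζ − ∫ ḡ dζ| ≤ ‖g‖_TV · sup_{x ∈ ℝ} |G(x) − G(x⁻)|, where ∫ h dζ := n^{−1/2}(∑_{i=1}^n h(x_i) − n ∫ h dμ₀). -/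
open MeasureTheory Filter Topology Set Function

lemma aux_sum_edist (g : ℝ → ℝ) (hg : BoundedVariationOn g univ) (S : Finset ℝ) :
    ∀ b : ℝ, (∀ t ∈ S, t < b) →
      ∑ t ∈ S, edist (g t) (g.rightLim t) ≤ eVariationOn g (Iic b) := by
  induction S using Finset.induction_on_max with
  | empty => intro b _; simp
  | insert a S hS ih =>
    intro b hb
    have hab : a < b := hb a (by simp)
    have hna : a ∉ S := fun h => lt_irrefl _ (hS a h)
    rw [Finset.sum_insert hna, add_comm]
    have hu : eVariationOn g (Iic b) = eVariationOn g (Iic a) + eVariationOn g (Icc a b) := by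
      rw [← eVariationOn.union g (x := a) ⟨self_mem_Iic, fun y hy => hy⟩
        (isLeast_Icc hab.le), Iic_union_Icc_eq_Iic hab.le]
    rw [hu]
    refine add_le_add (ih a hS) ?_
    have ht : Tendsto (fun s => edist (g a) (g s)) (𝓝[>] a) (𝓝 (edist (g a) (g.rightLim a))) :=
      tendsto_const_nhds.edist (hg.tendsto_rightLim a)
    refine le_of_tendsto ht ?_
    filter_upwards [Ioo_mem_nhdsGT hab] with s hs
    exact eVariationOn.edist_le g (left_mem_Icc.2 hab.le) ⟨hs.1.le, hs.2.le⟩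

lemma aux_sum_abs (g : ℝ → ℝ) (hg : BoundedVariationOn g univ) (S : Finset ℝ) :
    ∑ t ∈ S, |g t - g.rightLim t| ≤ (eVariationOn g univ).toReal := by
  obtain ⟨b, hb⟩ := S.bddAbove
  have h := (aux_sum_edist g hg S (b + 1)
    (fun t ht => (hb ht).trans_lt (lt_add_one b))).trans (eVariationOn.mono g (subset_univ _))
  have h2 := ENNReal.toReal_mono hg h
  rw [ENNReal.toReal_sum (fun t _ => edist_ne_top _ _)] at h2
  simpa [edist_dist, Real.dist_eq] using h2

/-- **Lemma 3 of the paper.** Let `ζ = n^{-1/2}(∑ δ_{xᵢ} - n μ₀)` be the signed empirical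
measure of a sample `x₁, …, x_n` with respect to a distribution function `F₀` with
Lebesgue–Stieltjes measure `μ₀`, with 'distribution function'
`G(t) = n^{-1/2} ∑ᵢ (1{xᵢ ≤ t} - F₀(t))`. For a bounded Borel function `g` of finite total
variation with right-continuous version `ḡ(x) = lim_{y ↓ x} g(y)`,
`|∫ g dζ - ∫ ḡ dζ| ≤ ‖g‖_TV · sup_x |G(x) - G(x⁻)|`. -/
theorem empirical_right_continuous_version_bound
    (n : ℕ) (x : Fin n → ℝ)
    (F₀ : ℝ → ℝ) (hFmono : Monotone F₀)
    (hFrc : ∀ t, ContinuousWithinAt F₀ (Set.Ici t) t)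
    (hFbot : Tendsto F₀ atBot (nhds 0)) (hFtop : Tendsto F₀ atTop (nhds 1))
    (μ₀ : Measure ℝ) [IsProbabilityMeasure μ₀]
    (hμ₀ : ∀ a b : ℝ, a ≤ b → μ₀ (Set.Ioc a b) = ENNReal.ofReal (F₀ b - F₀ a))
    (g : ℝ → ℝ) (hgb : ∃ C, ∀ t, |g t| ≤ C) (hgm : Measurable g)
    (hgTV : eVariationOn g Set.univ ≠ ⊤)
    (G : ℝ → ℝ)
    (hG : ∀ t, G t = (Real.sqrt n)⁻¹ * ∑ i, ((if x i ≤ t then (1 : ℝ) else 0) - F₀ t)) :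
    |(Real.sqrt n)⁻¹ * ((∑ i, g (x i)) - n * ∫ t, g t ∂μ₀)
        - (Real.sqrt n)⁻¹ * ((∑ i, Function.rightLim g (x i))
            - n * ∫ t, Function.rightLim g t ∂μ₀)|
      ≤ (eVariationOn g Set.univ).toReal * ⨆ t : ℝ, |G t - Function.leftLim G t| := by
  have hbv : BoundedVariationOn g univ := hgTV
  set V := (eVariationOn g univ).toReal with hV
  set c := (Real.sqrt n)⁻¹ with hc
  have hc0 : 0 ≤ c := by positivity
  set d : ℝ → ℝ := fun t => g t - g.rightLim t with hd
  -- summability of jumps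
  have hsum : ∀ S : Finset ℝ, ∑ t ∈ S, |d t| ≤ V := aux_sum_abs g hbv
  have hdabs : Summable (fun t => |d t|) := summable_of_sum_le (fun t => abs_nonneg _) hsum
  have hdV : ∑' t, |d t| ≤ V := hdabs.tsum_le_of_sum_le hsum
  have hdc : (support d).Countable := hdabs.of_abs.countable_support
  -- measurability
  have hrm : Measurable g.rightLim := by
    refine measurable_of_tendsto_metrizable
      (f := fun (k : ℕ) t => g (t + 1 / ((k : ℝ) + 1))) (fun k => by fun_prop) ?_
    rw [tendsto_pi_nhds]
    intro t
    refine (hbv.tendsto_rightLim t).comp ?_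
    refine tendsto_nhdsWithin_iff.2 ⟨?_, Eventually.of_forall fun k => ?_⟩
    · simpa using tendsto_const_nhds.add (tendsto_one_div_add_atTop_nhds_zero_nat (𝕜 := ℝ))
    · have : (0 : ℝ) < 1 / ((k : ℝ) + 1) := by positivity
      simpa using this
  obtain ⟨C, hC⟩ := hgb
  have hgi : Integrable g μ₀ :=
    Integrable.of_bound hgm.aestronglyMeasurable C (Eventually.of_forall hC)
  have hri : Integrable g.rightLim μ₀ := by
    refine Integrable.of_bound hrm.aestronglyMeasurable C (Eventually.of_forall fun t => ?_)
    exact le_of_tendsto (hbv.tendsto_rightLim t).norm (Eventually.of_forall hC)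
  have hdi : Integrable d μ₀ := hgi.sub hri
  set p : ℝ → ℝ := fun t => μ₀.real {t} with hp
  have hp0 : ∀ t, 0 ≤ p t := fun t => measureReal_nonneg
  have hp1 : ∀ t, p t ≤ 1 := fun t => measureReal_le_one
  have hint : HasSum (fun t => d t * p t) (∫ t, d t ∂μ₀) := by
    have hs : Summable (fun t => d t * p t) := by
      refine Summable.of_norm_bounded hdabs fun t => ?_
      rw [Real.norm_eq_abs, abs_mul, abs_of_nonneg (hp0 t)]
      exact mul_le_of_le_one_right (abs_nonneg _) (hp1 t)
    have he : ∫ t, d t ∂μ₀ = ∑' t, d t * p t := by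
      rw [← setIntegral_support, setIntegral_countable d hdc hdi.integrableOn,
        tsum_subtype (support d) (fun t => μ₀.real {t} • d t)]
      refine tsum_congr fun t => ?_
      by_cases h : d t = 0
      · simp [h]
      · rw [indicator_of_mem (by simpa using h)]
        simp [hp, mul_comm]
    rw [he]; exact hs.hasSum
  set N : ℝ → ℝ := fun t => ∑ i, (if x i = t then (1 : ℝ) else 0) with hN
  have hsumx : HasSum (fun t => d t * N t) (∑ i, d (x i)) := by
    have : ∀ i ∈ Finset.univ, HasSum (fun t => d t * (if x i = t then (1 : ℝ) else 0)) (d (x i)) := by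
      intro i _
      have := hasSum_single (f := fun t => d t * (if x i = t then (1 : ℝ) else 0)) (x i)
        (fun t ht => by simp [Ne.symm ht])
      simpa using this
    simp only [hN, Finset.mul_sum]
    exact hasSum_sum this
  -- the singletons
  have hpF : ∀ t, p t = F₀ t - leftLim F₀ t := by
    intro t
    let f : StieltjesFunction ℝ := ⟨F₀, hFmono, hFrc⟩
    have hμ : μ₀ = f.measure := by
      refine Measure.ext_of_Ioc _ _ fun a b hab => ?_
      rw [hμ₀ a b hab.le, f.measure_Ioc]
    have : μ₀ {t} = ENNReal.ofReal (F₀ t - leftLim F₀ t) := by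
      rw [hμ, f.measure_singleton]
    simp only [hp, measureReal_def, this]
    exact ENNReal.toReal_ofReal (sub_nonneg.2 (hFmono.leftLim_le le_rfl))
  have hJ : ∀ t, G t - leftLim G t = c * (N t - n * p t) := by
    intro t
    have hl : Tendsto G (𝓝[<] t)
        (𝓝 (c * ∑ i, ((if x i < t then (1 : ℝ) else 0) - leftLim F₀ t))) := by
      have : G = fun t => c * ∑ i, ((if x i ≤ t then (1 : ℝ) else 0) - F₀ t) := funext hG
      rw [this]
      refine Tendsto.const_mul _ (tendsto_finsetSum _ fun i _ => Tendsto.sub ?_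
        (hFmono.tendsto_leftLim t))
      refine tendsto_const_nhds.congr' ?_
      by_cases h : x i < t
      · filter_upwards [Ioo_mem_nhdsLT h] with s hs
        simp [h, hs.1.le]
      · filter_upwards [self_mem_nhdsWithin] with s hs
        have : ¬ x i ≤ s := fun h' => h (h'.trans_lt hs)
        simp [h, this]
    rw [leftLim_eq_of_tendsto hl, hG, ← mul_sub, ← Finset.sum_sub_distrib, hpF]
    congr 1
    have : (n : ℝ) * (F₀ t - leftLim F₀ t) = ∑ i : Fin n, (F₀ t - leftLim F₀ t) := by simp; ring
    rw [this, hN, ← Finset.sum_sub_distrib]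
    refine Finset.sum_congr rfl fun i _ => ?_
    rcases lt_trichotomy (x i) t with h | h | h
    · simp [h, h.le, h.ne]
    · simp [h]; ring
    · simp [h.not_ge, h.not_gt, h.ne']; ring
  set M := ⨆ t : ℝ, |G t - leftLim G t| with hM
  have hbdd : BddAbove (range fun t : ℝ => |G t - leftLim G t|) := by
    refine ⟨c * (n + n), ?_⟩
    rintro _ ⟨t, rfl⟩
    simp only [hJ, abs_mul, abs_of_nonneg hc0]
    refine mul_le_mul_of_nonneg_left ?_ hc0
    have hN0 : 0 ≤ N t := Finset.sum_nonneg fun i _ => by split_ifs <;> norm_num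
    have hN1 : N t ≤ n := by
      calc N t ≤ ∑ i : Fin n, (1 : ℝ) := Finset.sum_le_sum fun i _ => by split_ifs <;> norm_num
        _ = n := by simp
    have hn : (0 : ℝ) ≤ n := Nat.cast_nonneg n
    have h1 := mul_nonneg hn (hp0 t)
    have h2 := mul_le_of_le_one_right hn (hp1 t)
    rw [abs_le]; constructor <;> linarith
  have hle : ∀ t, |c * (N t - n * p t)| ≤ M := fun t => by
    rw [← hJ]; exact le_ciSup hbdd t
  have hM0 : 0 ≤ M := (abs_nonneg _).trans (hle 0)
  have hmain : HasSum (fun t => d t * (c * (N t - n * p t)))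
      (c * (∑ i, d (x i) - n * ∫ t, d t ∂μ₀)) := by
    have := (hsumx.sub (hint.mul_left (n : ℝ))).mul_left c
    have hfun : (fun t => d t * (c * (N t - n * p t)))
        = fun t => c * (d t * N t - n * (d t * p t)) := by
      funext t; ring
    rw [hfun]; exact this
  have heq : c * ((∑ i, g (x i)) - n * ∫ t, g t ∂μ₀)
        - c * ((∑ i, g.rightLim (x i)) - n * ∫ t, g.rightLim t ∂μ₀)
      = c * (∑ i, d (x i) - n * ∫ t, d t ∂μ₀) := by
    rw [hd, integral_sub hgi hri, Finset.sum_sub_distrib]; ring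
  rw [heq, ← Real.norm_eq_abs]
  calc _ ≤ (∑' t, |d t|) * M := by
        refine hmain.norm_le_of_bounded (hdabs.hasSum.mul_right M) fun t => ?_
        rw [Real.norm_eq_abs, abs_mul]
        exact mul_le_mul_of_nonneg_left (hle t) (abs_nonneg _)
    _ ≤ V * M := mul_le_mul_of_nonneg_right hdV hM0
end

section
/- (Decoupling Lemma.) Let F₀ be a distribution function with Lebesgue–Stieltjes probability measure μ₀. Let Z : ℝ → ℝ be right-continuous of bounded variation with Z(t) → 0 as t → ±∞, written Z = Z₁ − Z₂ with Z₁, Z₂ bounded nondecreasing right-continuous, with Lebesgue–Stieltjes measures ζ₁, ζ₂. Let g : ℝ → ℝ be right-continuous with ‖g‖_TV < ∞ and ‖g‖_{L₁(F₀)} := ∫ |g| dμ₀ < ∞, and let β > 0. Then |∫ g dZ| ≤ (2β^{−1}·‖g‖_{L₁(F₀)} + 6·‖g‖_TV)·Ψ_{2β,F₀}(Z) + β^{−1}·‖g‖_{L₁(F₀)}·𝔤_{β,F₀}(Z), where ∫ g dZ := ∫ g dζ₁ − ∫ g dζ₂. -/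
open MeasureTheory Filter Topology Set Function

/-- The modulus `Ψ_{β,F₀}(Z) = sup { |Z(s) - Z(t)| : |F₀(s) - F₀(t)| ≤ β }`
(with `sSup ∅ = 0` by convention in `ℝ`). -/
noncomputable def Psi (β : ℝ) (F₀ Z : ℝ → ℝ) : ℝ :=
  sSup {r : ℝ | ∃ s t : ℝ, |F₀ s - F₀ t| ≤ β ∧ r = |Z s - Z t|}

/-- The large-jump modulus `𝔤_{β,F₀}(Z) = sup { |Z(s) - Z(s⁻)| : F₀(s) - F₀(s⁻) > β }`
(with `sSup ∅ = 0` by convention in `ℝ`). -/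
noncomputable def bigJump (β : ℝ) (F₀ Z : ℝ → ℝ) : ℝ :=
  sSup {r : ℝ | ∃ s : ℝ,
    β < F₀ s - Function.leftLim F₀ s ∧ r = |Z s - Function.leftLim Z s|}


noncomputable def dApp (g : ℝ → ℝ) (a d : ℝ) (n : ℕ) (t : ℝ) : ℝ :=
  g (a + d / ((n : ℝ) + 1) * ((⌈(t - a) / (d / ((n : ℝ) + 1))⌉ : ℤ) : ℝ))

lemma dApp_meas (g : ℝ → ℝ) (a d : ℝ) (n : ℕ) : Measurable (dApp g a d n) := by
  have h1 : Measurable (fun t : ℝ => ⌈(t - a) / (d / ((n : ℝ) + 1))⌉) :=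
    Int.measurable_ceil.comp (by fun_prop)
  exact (measurable_from_top (f := fun k : ℤ => g (a + d / ((n : ℝ) + 1) * (k : ℝ)))).comp h1

lemma dApp_tendsto (g : ℝ → ℝ) (hg_rc : ∀ t, ContinuousWithinAt g (Set.Ici t) t)
    (a d : ℝ) (hd : 0 < d) (t : ℝ) :
    Tendsto (fun n : ℕ => dApp g a d n t) atTop (𝓝 (g t)) := by
  refine (hg_rc t).tendsto.comp ?_
  have hpos : ∀ n : ℕ, 0 < d / ((n : ℝ) + 1) := fun n => by positivity
  have hlo : ∀ n : ℕ, t ≤ a + d / ((n : ℝ) + 1) * ((⌈(t - a) / (d / ((n : ℝ) + 1))⌉ : ℤ) : ℝ) := by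
    intro n
    have := Int.le_ceil ((t - a) / (d / ((n : ℝ) + 1)))
    rw [div_le_iff₀ (hpos n)] at this
    linarith
  have hhi : ∀ n : ℕ, a + d / ((n : ℝ) + 1) * ((⌈(t - a) / (d / ((n : ℝ) + 1))⌉ : ℤ) : ℝ)
      ≤ t + d / ((n : ℝ) + 1) := by
    intro n
    have := (Int.ceil_lt_add_one ((t - a) / (d / ((n : ℝ) + 1)))).le
    have h2 := mul_le_mul_of_nonneg_left this (hpos n).le
    rw [mul_add, mul_div_cancel₀ _ (hpos n).ne'] at h2
    linarith
  rw [tendsto_nhdsWithin_iff]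
  refine ⟨?_, Eventually.of_forall hlo⟩
  refine tendsto_of_tendsto_of_tendsto_of_le_of_le tendsto_const_nhds ?_ hlo hhi
  have h := (tendsto_one_div_add_atTop_nhds_zero_nat (𝕜 := ℝ)).const_mul d
  have h3 := h.const_add t
  simpa [div_eq_mul_inv] using h3

lemma rc_measurable (g : ℝ → ℝ) (hg_rc : ∀ t, ContinuousWithinAt g (Set.Ici t) t) :
    Measurable g :=
  measurable_of_tendsto_metrizable (fun n => dApp_meas g 0 1 n)
    (tendsto_pi_nhds.2 fun t => dApp_tendsto g hg_rc 0 1 one_pos t)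

lemma abel_bound (G Y V : ℕ → ℝ) (M : ℝ) (hV : ∀ i, |G (i+1) - G i| ≤ V (i+1) - V i) (N : ℕ)
    (hM : ∀ i, i ≤ N → |Y i - Y 0| ≤ M) :
    |∑ i ∈ Finset.range N, G (i+1) * (Y (i+1) - Y i) - G N * (Y N - Y 0)| ≤ (V N - V 0) * M := by
  induction N with
  | zero => simp
  | succ N ih =>
    have h1 := ih (fun i hi => hM i (by omega))
    have h2 := hM N (by omega)
    have h3 : |(G (N+1) - G N) * (Y N - Y 0)| ≤ (V (N+1) - V N) * M := by
      rw [abs_mul]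
      exact mul_le_mul (hV N) h2 (abs_nonneg _) ((abs_nonneg _).trans (hV N))
    rw [Finset.sum_range_succ]
    have e : ∑ i ∈ Finset.range N, G (i+1) * (Y (i+1) - Y i) + G (N+1) * (Y (N+1) - Y N)
        - G (N+1) * (Y (N+1) - Y 0) =
        (∑ i ∈ Finset.range N, G (i+1) * (Y (i+1) - Y i) - G N * (Y N - Y 0))
        - (G (N+1) - G N) * (Y N - Y 0) := by ring
    rw [e]
    calc _ ≤ _ := abs_sub _ _
      _ ≤ _ := add_le_add h1 h3
      _ = _ := by ring

lemma bdd_integrable (ζ : Measure ℝ) [IsFiniteMeasure ζ] (f : ℝ → ℝ) (hf : Measurable f) (C : ℝ)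
    (hC : ∀ t, |f t| ≤ C) : Integrable f ζ :=
  Integrable.of_bound hf.aestronglyMeasurable C (Eventually.of_forall hC)

lemma real_Ioc (ζ : Measure ℝ) (W : ℝ → ℝ) (hW : Monotone W)
    (hζ : ∀ a b : ℝ, a ≤ b → ζ (Set.Ioc a b) = ENNReal.ofReal (W b - W a)) (a b : ℝ) (hab : a ≤ b) :
    ζ.real (Set.Ioc a b) = W b - W a := by
  rw [Measure.real, hζ a b hab, ENNReal.toReal_ofReal (sub_nonneg.2 (hW hab))]

lemma dApp_integral (g : ℝ → ℝ) (C : ℝ) (hC : ∀ t, |g t| ≤ C)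
    (ζ : Measure ℝ) [IsFiniteMeasure ζ] (W : ℝ → ℝ) (hW : Monotone W)
    (hζ : ∀ a b : ℝ, a ≤ b → ζ (Set.Ioc a b) = ENNReal.ofReal (W b - W a))
    (a b : ℝ) (hab : a < b) (n : ℕ) (x : ℕ → ℝ) (hx : ∀ i, x i = a + (b - a) / ((n : ℝ) + 1) * i) :
    ∫ t in a..b, dApp g a (b - a) n t ∂ζ =
      ∑ i ∈ Finset.range (n+1), g (x (i+1)) * (W (x (i+1)) - W (x i)) := by
  have hδ : 0 < (b - a) / ((n : ℝ) + 1) := by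
    have := sub_pos.2 hab
    positivity
  have hI : Integrable (dApp g a (b - a) n) ζ :=
    bdd_integrable ζ _ (dApp_meas _ _ _ _) C (fun t => hC _)
  have h0 : x 0 = a := by simp [hx]
  have hN : x (n+1) = b := by
    rw [hx]; push_cast; field_simp; ring
  have hs := intervalIntegral.sum_integral_adjacent_intervals (f := dApp g a (b - a) n) (μ := ζ)
    (a := x) (n := n+1) (fun k _ => hI.intervalIntegrable)
  rw [h0, hN] at hs
  rw [← hs]
  refine Finset.sum_congr rfl fun i _ => ?_
  have hle : x i ≤ x (i+1) := by
    rw [hx, hx]; push_cast; nlinarith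
  rw [intervalIntegral.integral_of_le hle]
  have hc : ∀ t ∈ Ioc (x i) (x (i+1)), dApp g a (b - a) n t = g (x (i+1)) := by
    intro t ht
    have : ⌈(t - a) / ((b - a) / ((n : ℝ) + 1))⌉ = ((i + 1 : ℕ) : ℤ) := by
      rw [Int.ceil_eq_iff]
      have h1 := ht.1
      have h2 := ht.2
      rw [hx] at h1 h2
      push_cast at h2 ⊢
      rw [lt_div_iff₀ hδ, div_le_iff₀ hδ]
      constructor <;> nlinarith
    rw [dApp, this, hx (i+1)]
    simp
  rw [setIntegral_congr_fun measurableSet_Ioc hc, setIntegral_const, real_Ioc ζ W hW hζ _ _ hle,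
    smul_eq_mul, mul_comm]

lemma dApp_int_tendsto (g : ℝ → ℝ) (hg_rc : ∀ t, ContinuousWithinAt g (Set.Ici t) t)
    (C : ℝ) (hC : ∀ t, |g t| ≤ C) (ζ : Measure ℝ) [IsFiniteMeasure ζ] (a b d : ℝ) (hd : 0 < d) :
    Tendsto (fun n : ℕ => ∫ t in a..b, dApp g a d n t ∂ζ) atTop (𝓝 (∫ t in a..b, g t ∂ζ)) := by
  refine intervalIntegral.tendsto_integral_filter_of_dominated_convergence (fun _ => C) ?_ ?_ ?_ ?_
  · exact Eventually.of_forall fun n => (dApp_meas _ _ _ _).aestronglyMeasurable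
  · exact Eventually.of_forall fun n => Eventually.of_forall fun t _ => hC _
  · exact (integrable_const C).intervalIntegrable
  · exact Eventually.of_forall fun t _ => dApp_tendsto g hg_rc a d hd t

lemma interval_bound (g : ℝ → ℝ) (hg_rc : ∀ t, ContinuousWithinAt g (Set.Ici t) t)
    (C : ℝ) (hC : ∀ t, |g t| ≤ C)
    (v : ℝ → ℝ) (hv : ∀ x y, x ≤ y → |g y - g x| ≤ v y - v x)
    (Z Z₁ Z₂ : ℝ → ℝ) (hZ : ∀ t, Z t = Z₁ t - Z₂ t)
    (hZ₁mono : Monotone Z₁) (hZ₂mono : Monotone Z₂)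
    (ζ₁ ζ₂ : Measure ℝ) [IsFiniteMeasure ζ₁] [IsFiniteMeasure ζ₂]
    (hζ₁ : ∀ a b : ℝ, a ≤ b → ζ₁ (Set.Ioc a b) = ENNReal.ofReal (Z₁ b - Z₁ a))
    (hζ₂ : ∀ a b : ℝ, a ≤ b → ζ₂ (Set.Ioc a b) = ENNReal.ofReal (Z₂ b - Z₂ a))
    (a b : ℝ) (hab : a ≤ b) (M : ℝ) (hM : ∀ x, a ≤ x → x ≤ b → |Z x - Z a| ≤ M) :
    |(∫ t in a..b, g t ∂ζ₁) - (∫ t in a..b, g t ∂ζ₂) - g b * (Z b - Z a)| ≤ (v b - v a) * M := by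
  rcases hab.eq_or_lt with rfl | hab
  · simp
  have hd := sub_pos.2 hab
  have ht := (((dApp_int_tendsto g hg_rc C hC ζ₁ a b (b-a) hd).sub
    (dApp_int_tendsto g hg_rc C hC ζ₂ a b (b-a) hd)).sub_const (g b * (Z b - Z a))).abs
  refine le_of_tendsto ht (Eventually.of_forall fun n => ?_)
  have hδ : 0 < (b - a) / ((n : ℝ) + 1) := by positivity
  set x : ℕ → ℝ := fun i => a + (b - a) / ((n : ℝ) + 1) * i with hx
  have hx' : ∀ i, x i = a + (b - a) / ((n : ℝ) + 1) * i := fun i => rfl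
  rw [dApp_integral g C hC ζ₁ Z₁ hZ₁mono hζ₁ a b hab n x hx',
    dApp_integral g C hC ζ₂ Z₂ hZ₂mono hζ₂ a b hab n x hx', ← Finset.sum_sub_distrib]
  have h0 : x 0 = a := by simp [hx]
  have hN : x (n+1) = b := by
    rw [hx']; push_cast; field_simp; ring
  have hmono : Monotone x := by
    intro i j hij
    have : (i : ℝ) ≤ j := by exact_mod_cast hij
    simp only [hx]; gcongr
  have := abel_bound (fun i => g (x i)) (fun i => Z (x i)) (fun i => v (x i)) M
    (fun i => hv _ _ (hmono (Nat.le_succ i))) (n+1) (fun i hi => by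
      rw [h0]; exact hM _ (by rw [← h0]; exact hmono (Nat.zero_le _)) (by rw [← hN]; exact hmono hi))
  simp only [h0, hN] at this
  refine le_trans (le_of_eq ?_) this
  congr 2
  refine Finset.sum_congr rfl fun i _ => ?_
  rw [hZ, hZ]; ring

structure DS (F Z Z₁ Z₂ g v : ℝ → ℝ) (μ ζ₁ ζ₂ : Measure ℝ) (β P G C T : ℝ) : Prop where
  Fmono : Monotone F
  Frc : ∀ t, ContinuousWithinAt F (Set.Ici t) t
  Fbot : Tendsto F atBot (nhds 0)
  Ftop : Tendsto F atTop (nhds 1)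
  hμ : ∀ a b : ℝ, a ≤ b → μ (Set.Ioc a b) = ENNReal.ofReal (F b - F a)
  hZ : ∀ t, Z t = Z₁ t - Z₂ t
  m1 : Monotone Z₁
  m2 : Monotone Z₂
  hζ₁ : ∀ a b : ℝ, a ≤ b → ζ₁ (Set.Ioc a b) = ENNReal.ofReal (Z₁ b - Z₁ a)
  hζ₂ : ∀ a b : ℝ, a ≤ b → ζ₂ (Set.Ioc a b) = ENNReal.ofReal (Z₂ b - Z₂ a)
  grc : ∀ t, ContinuousWithinAt g (Set.Ici t) t
  hC : ∀ t, |g t| ≤ C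
  hv : ∀ x y, x ≤ y → |g y - g x| ≤ v y - v x
  v0 : ∀ x, 0 ≤ v x
  vT : ∀ x, v x ≤ T
  hβ : 0 < β
  hP : ∀ s t, |F s - F t| ≤ 2 * β → |Z s - Z t| ≤ P
  hG : ∀ s, β < F s - Function.leftLim F s → |Z s - Function.leftLim Z s| ≤ G
  P0 : 0 ≤ P
  G0 : 0 ≤ G

lemma seq_tendsto (b : ℝ) : Tendsto (fun n : ℕ => b - 1 / ((n : ℝ) + 1)) atTop (𝓝[<] b) := by
  rw [tendsto_nhdsWithin_iff]
  constructor
  · simpa using (tendsto_one_div_add_atTop_nhds_zero_nat (𝕜 := ℝ)).const_sub b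
  · refine Eventually.of_forall fun n => ?_
    have : (0 : ℝ) < 1 / ((n : ℝ) + 1) := by positivity
    simpa using this

lemma jump_tendsto (ζ : Measure ℝ) [IsFiniteMeasure ζ] (f : ℝ → ℝ) (hf : Measurable f) (C : ℝ)
    (hC : ∀ t, |f t| ≤ C) (b : ℝ) :
    Tendsto (fun n : ℕ => ∫ t in (b - 1 / ((n : ℝ) + 1))..b, f t ∂ζ) atTop
      (𝓝 (f b * ζ.real {b})) := by
  have h := tendsto_setIntegral_of_antitone (μ := ζ) (f := f)
    (s := fun n : ℕ => Ioc (b - 1 / ((n : ℝ) + 1)) b)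
    (fun n => measurableSet_Ioc) (fun m n hmn => Ioc_subset_Ioc_left (by gcongr))
    ⟨0, (bdd_integrable ζ f hf C hC).integrableOn⟩
  have hI : ⋂ n : ℕ, Ioc (b - 1 / ((n : ℝ) + 1)) b = {b} := by
    ext x
    simp only [mem_iInter, mem_Ioc, mem_singleton_iff]
    constructor
    · intro hx
      refine le_antisymm (hx 0).2 ?_
      refine le_of_tendsto ((seq_tendsto b).mono_right nhdsWithin_le_nhds)
        (Eventually.of_forall fun n => (hx n).1.le)
    · rintro rfl n
      have : (0 : ℝ) < 1 / ((n : ℝ) + 1) := by positivity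
      exact ⟨by linarith, le_rfl⟩
  rw [hI, integral_singleton, smul_eq_mul, mul_comm] at h
  refine h.congr fun n => ?_
  have : (0 : ℝ) < 1 / ((n : ℝ) + 1) := by positivity
  rw [intervalIntegral.integral_of_le (by linarith)]

lemma jump_real (ζ : Measure ℝ) [IsFiniteMeasure ζ] (W : ℝ → ℝ) (hW : Monotone W)
    (hζ : ∀ a b : ℝ, a ≤ b → ζ (Set.Ioc a b) = ENNReal.ofReal (W b - W a)) (b : ℝ) :
    ζ.real {b} = W b - leftLim W b := by
  have h := jump_tendsto ζ (fun _ => 1) measurable_const 1 (by simp) b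
  rw [one_mul] at h
  have h2 : Tendsto (fun n : ℕ => W b - W (b - 1 / ((n : ℝ) + 1))) atTop
      (𝓝 (W b - leftLim W b)) := ((hW.tendsto_leftLim b).comp (seq_tendsto b)).const_sub _
  refine tendsto_nhds_unique h (h2.congr fun n => ?_)
  have : (0 : ℝ) < 1 / ((n : ℝ) + 1) := by positivity
  rw [intervalIntegral.integral_of_le (by linarith), setIntegral_const,
    real_Ioc ζ W hW hζ _ _ (by linarith)]
  simp

lemma DS.leftLimZ {F Z Z₁ Z₂ g v : ℝ → ℝ} {μ ζ₁ ζ₂ : Measure ℝ} {β P G C T : ℝ}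
    (D : DS F Z Z₁ Z₂ g v μ ζ₁ ζ₂ β P G C T) (b : ℝ) :
    leftLim Z b = leftLim Z₁ b - leftLim Z₂ b := by
  apply leftLim_eq_of_tendsto
  have := (D.m1.tendsto_leftLim b).sub (D.m2.tendsto_leftLim b)
  exact this.congr fun t => (D.hZ t).symm

/-- bound on an interval where `Z` oscillates by at most `P` -/
lemma DS.small {F Z Z₁ Z₂ g v : ℝ → ℝ} {μ ζ₁ ζ₂ : Measure ℝ} [IsFiniteMeasure ζ₁]
    [IsFiniteMeasure ζ₂] {β P G C T : ℝ}
    (D : DS F Z Z₁ Z₂ g v μ ζ₁ ζ₂ β P G C T) (a b : ℝ) (hab : a ≤ b) (h : F b - F a ≤ 2 * β) :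
    |(∫ t in a..b, g t ∂ζ₁) - (∫ t in a..b, g t ∂ζ₂)| ≤ (|g b| + (v b - v a)) * P := by
  have hM : ∀ x, a ≤ x → x ≤ b → |Z x - Z a| ≤ P := by
    intro x h1 h2
    apply D.hP
    rw [abs_of_nonneg (sub_nonneg.2 (D.Fmono h1))]
    linarith [D.Fmono h2]
  have h1 := interval_bound g D.grc C D.hC v D.hv Z Z₁ Z₂ D.hZ D.m1 D.m2 ζ₁ ζ₂ D.hζ₁ D.hζ₂ a b hab P hM
  have h2 : |g b * (Z b - Z a)| ≤ |g b| * P := by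
    rw [abs_mul]; exact mul_le_mul_of_nonneg_left (hM b hab le_rfl) (abs_nonneg _)
  have h3 := abs_sub_abs_le_abs_sub ((∫ t in a..b, g t ∂ζ₁) - (∫ t in a..b, g t ∂ζ₂)) (g b * (Z b - Z a))
  linarith

lemma DS.step {F Z Z₁ Z₂ g v : ℝ → ℝ} {μ ζ₁ ζ₂ : Measure ℝ} [IsFiniteMeasure μ] [IsFiniteMeasure ζ₁]
    [IsFiniteMeasure ζ₂] {β P G C T : ℝ}
    (D : DS F Z Z₁ Z₂ g v μ ζ₁ ζ₂ β P G C T) (a b : ℝ) (hab : a ≤ b)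
    (h : ∀ x, x < b → F x - F a ≤ β) :
    |(∫ t in a..b, g t ∂ζ₁) - (∫ t in a..b, g t ∂ζ₂)| ≤ (|g b| + (v b - v a)) * P
      + β⁻¹ * (∫ t in a..b, |g t| ∂μ) * G := by
  have hgm := rc_measurable g D.grc
  have hβ := D.hβ
  have hβi : 0 < β⁻¹ := inv_pos.2 hβ
  have hint0 : 0 ≤ ∫ t in a..b, |g t| ∂μ :=
    intervalIntegral.integral_nonneg hab fun t _ => abs_nonneg _
  have hG0 := D.G0
  rcases hab.eq_or_lt with rfl | hlt
  · simp only [intervalIntegral.integral_same, sub_self, abs_zero, add_zero, mul_zero, zero_mul]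
    exact mul_nonneg (abs_nonneg _) D.P0
  by_cases hj : F b - leftLim F b ≤ β
  · have h1 : leftLim F b - F a ≤ β := by
      refine le_of_tendsto ((D.Fmono.tendsto_leftLim b).sub_const (F a)) ?_
      filter_upwards [self_mem_nhdsWithin] with x hx using h x hx
    have := D.small a b hab (by linarith)
    have h3 : 0 ≤ β⁻¹ * (∫ t in a..b, |g t| ∂μ) * G := by positivity
    linarith
  · push Not at hj
    have hi1 := bdd_integrable ζ₁ g hgm C D.hC
    have hi2 := bdd_integrable ζ₂ g hgm C D.hC
    have hJ := D.hG b hj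
    have hd : ζ₁.real {b} - ζ₂.real {b} = Z b - leftLim Z b := by
      rw [jump_real ζ₁ Z₁ D.m1 D.hζ₁, jump_real ζ₂ Z₂ D.m2 D.hζ₂, D.leftLimZ, D.hZ]; ring
    have ht := ((jump_tendsto ζ₁ g hgm C D.hC b).sub (jump_tendsto ζ₂ g hgm C D.hC b))
    rw [← mul_sub, hd] at ht
    have key : |(∫ t in a..b, g t ∂ζ₁) - (∫ t in a..b, g t ∂ζ₂)| ≤ (|g b| + (v b - v a)) * P
        + |g b * (Z b - leftLim Z b)| := by
      refine ge_of_tendsto (ht.abs.const_add _) ?_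
      have hev : ∀ᶠ n : ℕ in atTop, a < b - 1 / ((n : ℝ) + 1) :=
        ((seq_tendsto b).mono_right nhdsWithin_le_nhds).eventually (eventually_gt_nhds hlt)
      filter_upwards [hev] with n hn
      have hp : (0 : ℝ) < 1 / ((n : ℝ) + 1) := by positivity
      set c := b - 1 / ((n : ℝ) + 1) with hc
      have hcb : c < b := by linarith
      rw [← intervalIntegral.integral_add_adjacent_intervals (b := c)
        hi1.intervalIntegrable hi1.intervalIntegrable,
        ← intervalIntegral.integral_add_adjacent_intervals (μ := ζ₂) (a := a) (b := c)
        hi2.intervalIntegrable hi2.intervalIntegrable]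
      have h1 := D.small a c hn.le (by linarith [h c hcb])
      have h2 : |g c| ≤ |g b| + (v b - v c) := by
        have := abs_sub_abs_le_abs_sub (g c) (g b)
        rw [abs_sub_comm] at this
        linarith [D.hv c b hcb.le]
      have h3 : (|g c| + (v c - v a)) * P ≤ (|g b| + (v b - v a)) * P :=
        mul_le_mul_of_nonneg_right (by linarith) D.P0
      rw [add_sub_add_comm]
      refine (abs_add_le _ _).trans ?_
      gcongr
      linarith
    have h5 : |g b| * β ≤ ∫ t in a..b, |g t| ∂μ := by
      have e : ∫ t in ({b} : Set ℝ), |g t| ∂μ = (F b - leftLim F b) * |g b| := by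
        rw [integral_singleton, jump_real μ F D.Fmono D.hμ, smul_eq_mul]
      have h6 : ∫ t in ({b} : Set ℝ), |g t| ∂μ ≤ ∫ t in Ioc a b, |g t| ∂μ := by
        refine setIntegral_mono_set (bdd_integrable μ g hgm C D.hC).abs.integrableOn
          (Eventually.of_forall fun t => abs_nonneg _) ?_
        refine LE.le.eventuallyLE ?_
        simpa using hlt
      rw [intervalIntegral.integral_of_le hab]
      rw [e] at h6
      nlinarith [abs_nonneg (g b)]
    have h7 : |g b * (Z b - leftLim Z b)| ≤ β⁻¹ * (∫ t in a..b, |g t| ∂μ) * G := by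
      rw [abs_mul]
      refine mul_le_mul ?_ hJ (abs_nonneg _) (by positivity)
      rw [inv_mul_eq_div, le_div_iff₀ hβ]; exact h5
    linarith

noncomputable def Qf (F : ℝ → ℝ) (u : ℝ) : ℝ := sInf {x | u ≤ F x}

lemma Qf_le_iff (F : ℝ → ℝ) (hm : Monotone F) (hrc : ∀ t, ContinuousWithinAt F (Set.Ici t) t)
    (hbot : Tendsto F atBot (nhds 0)) (htop : Tendsto F atTop (nhds 1)) (u : ℝ) (h0 : 0 < u)
    (h1 : u < 1) (x : ℝ) : Qf F u ≤ x ↔ u ≤ F x := by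
  have hne : {x | u ≤ F x}.Nonempty := by
    obtain ⟨y, hy⟩ := (htop.eventually (eventually_gt_nhds h1)).exists
    exact ⟨y, hy.le⟩
  obtain ⟨z, hz⟩ := (hbot.eventually (eventually_lt_nhds h0)).exists
  have hbd : BddBelow {x | u ≤ F x} := by
    refine ⟨z, fun y hy => ?_⟩
    by_contra hlt
    push Not at hlt
    have h2 : u ≤ F y := hy
    linarith [hm hlt.le]
  constructor
  · intro h
    have hgt : ∀ y, Qf F u < y → u ≤ F y := by
      intro y hy
      obtain ⟨w, hw, hwy⟩ := exists_lt_of_csInf_lt hne hy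
      have h2 : u ≤ F w := hw
      exact h2.trans (hm hwy.le)
    have : u ≤ F (Qf F u) := by
      have ht : Tendsto F (𝓝[>] (Qf F u)) (𝓝 (F (Qf F u))) :=
        (hrc (Qf F u)).tendsto.mono_left (nhdsWithin_mono _ Ioi_subset_Ici_self)
      refine ge_of_tendsto ht ?_
      filter_upwards [self_mem_nhdsWithin] with y hy using hgt y hy
    exact this.trans (hm h)
  · intro h
    exact csInf_le hbd h

lemma Qf_map (F : ℝ → ℝ) (hm : Monotone F) (hrc : ∀ t, ContinuousWithinAt F (Set.Ici t) t)
    (hbot : Tendsto F atBot (nhds 0)) (htop : Tendsto F atTop (nhds 1))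
    (μ : Measure ℝ) [IsFiniteMeasure μ]
    (hμ : ∀ a b : ℝ, a ≤ b → μ (Set.Ioc a b) = ENNReal.ofReal (F b - F a)) :
    AEMeasurable (Qf F) (volume.restrict (Ioo (0:ℝ) 1)) ∧
    μ = Measure.map (Qf F) (volume.restrict (Ioo (0:ℝ) 1)) := by
  have hiff := Qf_le_iff F hm hrc hbot htop
  have hmon : MonotoneOn (Qf F) (Ioo (0:ℝ) 1) := by
    intro u hu w hw huw
    rw [hiff u hu.1 hu.2]
    exact huw.trans ((hiff w hw.1 hw.2 _).1 le_rfl)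
  have hae := aemeasurable_restrict_of_monotoneOn (μ := volume) measurableSet_Ioo hmon
  refine ⟨hae, ?_⟩
  refine Measure.ext_of_Ioc μ _ fun a b hab => ?_
  rw [Measure.map_apply_of_aemeasurable hae measurableSet_Ioc, hμ a b hab.le,
    Measure.restrict_apply' measurableSet_Ioo]
  have hF0 : ∀ x, 0 ≤ F x := hm.le_of_tendsto hbot
  have hF1 : ∀ x, F x ≤ 1 := hm.ge_of_tendsto htop
  apply le_antisymm
  · rw [← Real.volume_Ioo]
    refine measure_mono fun u hu => ?_
    have h0 : 0 < u := (hF0 a).trans_lt hu.1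
    have h1 : u < 1 := hu.2.trans_le (hF1 b)
    refine ⟨⟨?_, (hiff u h0 h1 b).2 hu.2.le⟩, h0, h1⟩
    rw [← not_le, hiff u h0 h1, not_le]; exact hu.1
  · rw [← Real.volume_Ioc]
    refine measure_mono fun u hu => ?_
    obtain ⟨⟨h2, h3⟩, h0, h1⟩ := hu
    rw [← not_le, hiff u h0 h1, not_le] at h2
    exact ⟨h2, (hiff u h0 h1 b).1 h3⟩

lemma DS.sum_bound {F Z Z₁ Z₂ g v : ℝ → ℝ} {μ ζ₁ ζ₂ : Measure ℝ} [IsFiniteMeasure μ]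
    {β P G C T : ℝ}
    (D : DS F Z Z₁ Z₂ g v μ ζ₁ ζ₂ β P G C T) (K : ℕ) (hK : K * β < 1) :
    ∑ k ∈ Finset.range K, |g (Qf F (((k+1 : ℕ) : ℝ) * β))| ≤ β⁻¹ * (∫ t, |g t| ∂μ) + T := by
  have hβ := D.hβ
  have hiff := Qf_le_iff F D.Fmono D.Frc D.Fbot D.Ftop
  obtain ⟨hae, hmap⟩ := Qf_map F D.Fmono D.Frc D.Fbot D.Ftop μ D.hμ
  have hgm := rc_measurable g D.grc
  have hgi : Integrable (fun t => |g t|) μ := (bdd_integrable μ g hgm C D.hC).abs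
  set f : ℝ → ℝ := fun u => |g (Qf F u)| with hf
  have hfint : IntegrableOn f (Ioo 0 1) := by
    rw [hmap] at hgi
    exact (integrable_map_measure hgm.abs.aestronglyMeasurable hae).1 hgi
  have hfe : ∫ u in Ioo (0:ℝ) 1, f u = ∫ t, |g t| ∂μ := by
    conv_rhs => rw [hmap]
    rw [integral_map hae hgm.abs.aestronglyMeasurable]
  set w : ℕ → ℝ := fun k => if k = 0 then 0 else v (Qf F ((k : ℝ) * β)) with hw
  have hw0 : w 0 = 0 := by simp [hw]
  have hwT : ∀ k, w k ≤ T := by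
    intro k
    simp only [hw]
    split_ifs
    · exact (D.v0 0).trans (D.vT 0)
    · exact D.vT _
  have hvm : Monotone v := fun x y hxy => by
    have := (abs_nonneg _).trans (D.hv x y hxy); linarith
  have hii : ∀ c d : ℝ, 0 ≤ c → c ≤ d → d < 1 → IntervalIntegrable f volume c d := by
    intro c d hc hcd hd
    rw [intervalIntegrable_iff_integrableOn_Ioc_of_le hcd]
    exact hfint.mono_set fun u hu => ⟨hc.trans_lt hu.1, hu.2.trans_lt hd⟩
  have main : ∀ k : ℕ, k ≤ K → β * ∑ j ∈ Finset.range k, |g (Qf F (((j+1 : ℕ) : ℝ) * β))|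
      ≤ (∫ u in (0:ℝ)..(k * β), f u) + β * w k := by
    intro k
    induction k with
    | zero => intro _; simp [hw0]
    | succ k ih =>
      intro hk
      have ih := ih (by omega)
      have hkK : ((k + 1 : ℕ) : ℝ) * β < 1 :=
        (mul_le_mul_of_nonneg_right (by exact_mod_cast hk) hβ.le).trans_lt hK
      have hk0 : 0 ≤ (k : ℝ) * β := by positivity
      have hkk : (k : ℝ) * β ≤ ((k + 1 : ℕ) : ℝ) * β := by push_cast; nlinarith
      rw [Finset.sum_range_succ, mul_add,
        ← intervalIntegral.integral_add_adjacent_intervals (hii 0 (k * β) le_rfl hk0 (by linarith))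
          (hii _ _ hk0 hkk hkK)]
      set q := Qf F (((k+1 : ℕ) : ℝ) * β) with hq
      have hwk : w (k+1) = v q := by simp [hw, hq]
      have hpt : ∀ u ∈ Ioo ((k : ℝ) * β) (((k + 1 : ℕ) : ℝ) * β),
          |g q| - (w (k+1) - w k) ≤ f u := by
        intro u hu
        have hu0 : 0 < u := hk0.trans_lt hu.1
        have hu1 : u < 1 := hu.2.trans hkK
        have hle : Qf F u ≤ q := by
          rw [hiff u hu0 hu1]
          exact hu.2.le.trans ((hiff _ (hu0.trans hu.2) hkK _).1 le_rfl)
        have h1 := D.hv _ _ hle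
        have h2 := abs_sub_abs_le_abs_sub (g q) (g (Qf F u))
        have h3 : w k ≤ v (Qf F u) := by
          simp only [hw]
          split_ifs with h
          · exact D.v0 _
          · apply hvm
            have : 0 < (k : ℝ) * β := by
              have : 0 < (k : ℝ) := by exact_mod_cast Nat.pos_of_ne_zero h
              positivity
            rw [hiff _ this (hu.1.trans hu1)]
            exact hu.1.le.trans ((hiff u hu0 hu1 _).1 le_rfl)
        rw [hwk]
        simp only [hf]
        linarith
      have h4 := intervalIntegral.integral_mono_on_of_le_Ioo hkk
        (intervalIntegrable_const (c := |g q| - (w (k+1) - w k)) (μ := volume)) (hii _ _ hk0 hkk hkK) hpt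
      rw [intervalIntegral.integral_const, smul_eq_mul] at h4
      have e : ((k + 1 : ℕ) : ℝ) * β - (k : ℝ) * β = β := by push_cast; ring
      rw [e] at h4
      linarith
  have hm := main K le_rfl
  have h5 : (∫ u in (0:ℝ)..(K * β), f u) ≤ ∫ t, |g t| ∂μ := by
    rw [← hfe, intervalIntegral.integral_of_le (by positivity)]
    refine setIntegral_mono_set hfint (Eventually.of_forall fun t => abs_nonneg _) ?_
    refine LE.le.eventuallyLE ?_
    exact fun u hu => ⟨hu.1, hu.2.trans_lt hK⟩
  have h6 := hwT K
  rw [← mul_le_mul_iff_right₀ hβ, mul_add, mul_inv_cancel_left₀ hβ.ne']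
  nlinarith

lemma DS.finite_bound {F Z Z₁ Z₂ g v : ℝ → ℝ} {μ ζ₁ ζ₂ : Measure ℝ} [IsFiniteMeasure μ]
    [IsFiniteMeasure ζ₁] [IsFiniteMeasure ζ₂] {β P G C T : ℝ}
    (D : DS F Z Z₁ Z₂ g v μ ζ₁ ζ₂ β P G C T) (K : ℕ) (hK0 : K ≠ 0) (hK : K * β < 1)
    (hK1 : 1 ≤ (K + 1) * β) (A B : ℝ) (hA : A ≤ Qf F β) (hB : Qf F (K * β) ≤ B) :
    |(∫ t in A..B, g t ∂ζ₁) - (∫ t in A..B, g t ∂ζ₂)| ≤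
      (2 * β⁻¹ * (∫ t, |g t| ∂μ) + 6 * T) * P + β⁻¹ * (∫ t, |g t| ∂μ) * G := by
  have hβ := D.hβ
  have hiff := Qf_le_iff F D.Fmono D.Frc D.Fbot D.Ftop
  have hgm := rc_measurable g D.grc
  have hi1 := bdd_integrable ζ₁ g hgm C D.hC
  have hi2 := bdd_integrable ζ₂ g hgm C D.hC
  have him : Integrable (fun t => |g t|) μ := (bdd_integrable μ g hgm C D.hC).abs
  have hF0 : ∀ x, 0 ≤ F x := D.Fmono.le_of_tendsto D.Fbot
  have hF1 : ∀ x, F x ≤ 1 := D.Fmono.ge_of_tendsto D.Ftop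
  have hu : ∀ k : ℕ, k ≠ 0 → k ≤ K → 0 < (k : ℝ) * β ∧ (k : ℝ) * β < 1 := by
    intro k h0 hk
    have : 0 < (k : ℝ) := by exact_mod_cast Nat.pos_of_ne_zero h0
    refine ⟨by positivity, (mul_le_mul_of_nonneg_right (by exact_mod_cast hk) hβ.le).trans_lt hK⟩
  set t : ℕ → ℝ := fun k => if k = 0 then A else Qf F ((k : ℝ) * β) with ht
  have ht0 : t 0 = A := by simp [ht]
  have hts : ∀ k, t (k+1) = Qf F (((k + 1 : ℕ) : ℝ) * β) := fun k => by simp [ht]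
  have hFt : ∀ k, k ≤ K → (k : ℝ) * β ≤ F (t k) := by
    intro k hk
    rcases k with _ | k
    · simpa using hF0 _
    · obtain ⟨h0, h1⟩ := hu (k+1) (by omega) hk
      rw [hts]
      exact (hiff _ h0 h1 _).1 le_rfl
  have hlt : ∀ k, k + 1 ≤ K → ∀ x, x < t (k+1) → F x - F (t k) ≤ β := by
    intro k hk x hx
    obtain ⟨h0, h1⟩ := hu (k+1) (by omega) hk
    rw [hts, ← not_le, hiff _ h0 h1, not_le] at hx
    have := hFt k (by omega)
    push_cast at hx
    linarith
  have hmon : ∀ k, k + 1 ≤ K → t k ≤ t (k+1) := by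
    intro k hk
    obtain ⟨h0, h1⟩ := hu (k+1) (by omega) hk
    have h2 := (hiff _ h0 h1 _).1 le_rfl
    rcases k with _ | k
    · rw [ht0, hts]; simpa using hA
    · obtain ⟨h0', h1'⟩ := hu (k+1) (by omega) (by omega)
      rw [hts, hts, hiff _ h0' h1']
      refine le_trans ?_ h2
      push_cast; nlinarith
  have main : ∀ k, k ≤ K → A ≤ t k ∧ |(∫ s in A..(t k), g s ∂ζ₁) - (∫ s in A..(t k), g s ∂ζ₂)| ≤
      (∑ j ∈ Finset.range k, |g (Qf F (((j+1 : ℕ) : ℝ) * β))| + (v (t k) - v A)) * P +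
      β⁻¹ * (∫ s in A..(t k), |g s| ∂μ) * G := by
    intro k
    induction k with
    | zero => intro _; simp [ht0]
    | succ k ih =>
      intro hk
      obtain ⟨ihA, ih⟩ := ih (by omega)
      have hst := D.step (t k) (t (k+1)) (hmon k hk) (hlt k hk)
      refine ⟨ihA.trans (hmon k hk), ?_⟩
      rw [← intervalIntegral.integral_add_adjacent_intervals (b := t k)
        hi1.intervalIntegrable hi1.intervalIntegrable,
        ← intervalIntegral.integral_add_adjacent_intervals (μ := ζ₂) (b := t k)
        hi2.intervalIntegrable hi2.intervalIntegrable,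
        ← intervalIntegral.integral_add_adjacent_intervals (μ := μ) (b := t k)
        him.intervalIntegrable him.intervalIntegrable, add_sub_add_comm, Finset.sum_range_succ,
        ← hts]
      refine (abs_add_le _ _).trans ((add_le_add ih hst).trans (le_of_eq ?_))
      ring
  obtain ⟨hAt, hm⟩ := main K le_rfl
  have htK : t K = Qf F (K * β) := by simp [ht, hK0]
  rw [← htK] at hB
  have hlast := D.small (t K) B hB (by linarith [hF1 B, hFt K le_rfl])
  have hsum := D.sum_bound K hK
  have hgB : |g B| ≤ |g (t K)| + (v B - v (t K)) := by
    linarith [abs_sub_abs_le_abs_sub (g B) (g (t K)), D.hv _ _ hB]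
  have hgt : |g (t K)| ≤ ∑ k ∈ Finset.range K, |g (Qf F (((k+1 : ℕ) : ℝ) * β))| := by
    obtain ⟨K', rfl⟩ := Nat.exists_eq_succ_of_ne_zero hK0
    rw [htK]
    exact Finset.single_le_sum (f := fun k => |g (Qf F (((k+1 : ℕ) : ℝ) * β))|)
      (fun _ _ => abs_nonneg _) (Finset.mem_range.2 (Nat.lt_succ_self K'))
  have hint : ∫ s in A..(t K), |g s| ∂μ ≤ ∫ s, |g s| ∂μ := by
    rw [intervalIntegral.integral_of_le hAt]
    exact setIntegral_le_integral him (Eventually.of_forall fun _ => abs_nonneg _)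
  rw [← intervalIntegral.integral_add_adjacent_intervals (b := t K)
        hi1.intervalIntegrable hi1.intervalIntegrable,
        ← intervalIntegral.integral_add_adjacent_intervals (μ := ζ₂) (b := t K)
        hi2.intervalIntegrable hi2.intervalIntegrable, add_sub_add_comm]
  refine (abs_add_le _ _).trans ((add_le_add hm hlast).trans ?_)
  have h1 : β⁻¹ * (∫ s in A..(t K), |g s| ∂μ) * G ≤ β⁻¹ * (∫ s, |g s| ∂μ) * G := by
    have := D.G0
    have := inv_pos.2 hβ
    gcongr
  have hP := D.P0
  have h2 : (∑ j ∈ Finset.range K, |g (Qf F (((j+1 : ℕ) : ℝ) * β))| + (v (t K) - v A)) * P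
     + (|g B| + (v B - v (t K))) * P ≤ (2 * β⁻¹ * (∫ t, |g t| ∂μ) + 6 * T) * P := by
    rw [← add_mul]
    refine mul_le_mul_of_nonneg_right ?_ hP
    linarith [D.v0 A, D.vT A, D.vT B, D.v0 B, D.v0 (t K), D.vT (t K)]
  linarith

lemma var_mono (g : ℝ → ℝ) (hgTV : eVariationOn g Set.univ ≠ ⊤) (x y : ℝ) (hxy : x ≤ y) :
    |g y - g x| ≤ (eVariationOn g (Iic y)).toReal - (eVariationOn g (Iic x)).toReal := by
  have h1 : eVariationOn g (Iic x) + eVariationOn g (Icc x y) = eVariationOn g (Iic y) := by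
    rw [← eVariationOn.union g (s := Iic x) (t := Icc x y) (x := x) isGreatest_Iic
      (isLeast_Icc hxy), Iic_union_Icc_eq_Iic hxy]
  have hfin : ∀ s, eVariationOn g s ≠ ⊤ := fun s =>
    ne_top_of_le_ne_top hgTV (eVariationOn.mono g (subset_univ s))
  rw [← h1, ENNReal.toReal_add (hfin _) (hfin _)]
  have h2 := eVariationOn.edist_le g (right_mem_Icc.2 hxy) (left_mem_Icc.2 hxy)
  have h3 := ENNReal.toReal_mono (hfin _) h2
  rw [edist_dist, ENNReal.toReal_ofReal dist_nonneg, Real.dist_eq] at h3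
  linarith

/-- **Decoupling Lemma (Lemma 10).** Let `F₀` be a distribution function with
Lebesgue–Stieltjes probability measure `μ₀`, let `Z = Z₁ - Z₂` be right-continuous of bounded
variation, vanishing at `±∞`, with Lebesgue–Stieltjes measures `ζ₁, ζ₂`, and let `g` be
right-continuous with finite total variation and `g ∈ L₁(F₀)`. Then for every `β > 0`,
`|∫ g dZ| ≤ (2β⁻¹‖g‖_{L₁(F₀)} + 6‖g‖_TV)·Ψ_{2β,F₀}(Z) + β⁻¹‖g‖_{L₁(F₀)}·𝔤_{β,F₀}(Z)`. -/
theorem decoupling_lemma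
    (F₀ : ℝ → ℝ) (hFmono : Monotone F₀)
    (hFrc : ∀ t, ContinuousWithinAt F₀ (Set.Ici t) t)
    (hFbot : Tendsto F₀ atBot (nhds 0)) (hFtop : Tendsto F₀ atTop (nhds 1))
    (μ₀ : Measure ℝ) [IsProbabilityMeasure μ₀]
    (hμ₀ : ∀ a b : ℝ, a ≤ b → μ₀ (Set.Ioc a b) = ENNReal.ofReal (F₀ b - F₀ a))
    (Z Z₁ Z₂ : ℝ → ℝ) (hZ : ∀ t, Z t = Z₁ t - Z₂ t)
    (hZ₁mono : Monotone Z₁) (hZ₂mono : Monotone Z₂)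
    (hZ₁b : ∃ C, ∀ t, |Z₁ t| ≤ C) (hZ₂b : ∃ C, ∀ t, |Z₂ t| ≤ C)
    (hZ₁rc : ∀ t, ContinuousWithinAt Z₁ (Set.Ici t) t)
    (hZ₂rc : ∀ t, ContinuousWithinAt Z₂ (Set.Ici t) t)
    (hZbot : Tendsto Z atBot (nhds 0)) (hZtop : Tendsto Z atTop (nhds 0))
    (ζ₁ ζ₂ : Measure ℝ) [IsFiniteMeasure ζ₁] [IsFiniteMeasure ζ₂]
    (hζ₁ : ∀ a b : ℝ, a ≤ b → ζ₁ (Set.Ioc a b) = ENNReal.ofReal (Z₁ b - Z₁ a))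
    (hζ₂ : ∀ a b : ℝ, a ≤ b → ζ₂ (Set.Ioc a b) = ENNReal.ofReal (Z₂ b - Z₂ a))
    (g : ℝ → ℝ) (hg_rc : ∀ t, ContinuousWithinAt g (Set.Ici t) t)
    (hgTV : eVariationOn g Set.univ ≠ ⊤) (hgInt : Integrable g μ₀)
    (β : ℝ) (hβ : 0 < β) :
    |(∫ t, g t ∂ζ₁) - ∫ t, g t ∂ζ₂|
      ≤ (2 * β⁻¹ * (∫ t, |g t| ∂μ₀) + 6 * (eVariationOn g Set.univ).toReal)
            * Psi (2 * β) F₀ Z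
        + β⁻¹ * (∫ t, |g t| ∂μ₀) * bigJump β F₀ Z := by
  have hfin : ∀ s, eVariationOn g s ≠ ⊤ := fun s =>
    ne_top_of_le_ne_top hgTV (eVariationOn.mono g (subset_univ s))
  set T := (eVariationOn g Set.univ).toReal with hT
  obtain ⟨C₁, hC₁⟩ := hZ₁b
  obtain ⟨C₂, hC₂⟩ := hZ₂b
  have hZb : ∀ t, |Z t| ≤ C₁ + C₂ := fun t => by
    rw [hZ]; exact (abs_sub _ _).trans (add_le_add (hC₁ t) (hC₂ t))
  have hll : ∀ s, Tendsto Z (𝓝[<] s) (𝓝 (leftLim Z s)) := fun s =>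
    tendsto_leftLim_of_tendsto ⟨leftLim Z₁ s - leftLim Z₂ s,
      ((hZ₁mono.tendsto_leftLim s).sub (hZ₂mono.tendsto_leftLim s)).congr fun t => (hZ t).symm⟩
  have hgb : ∀ t, |g t| ≤ |g 0| + T := by
    intro t
    have h2 := eVariationOn.edist_le g (mem_univ t) (mem_univ 0)
    have h3 := ENNReal.toReal_mono (hfin _) h2
    rw [edist_dist, ENNReal.toReal_ofReal dist_nonneg, Real.dist_eq] at h3
    linarith [abs_sub_abs_le_abs_sub (g t) (g 0)]
  have hbP : BddAbove {r : ℝ | ∃ s t : ℝ, |F₀ s - F₀ t| ≤ 2 * β ∧ r = |Z s - Z t|} := by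
    refine ⟨(C₁ + C₂) + (C₁ + C₂), ?_⟩
    rintro r ⟨s, t, _, rfl⟩
    exact (abs_sub _ _).trans (add_le_add (hZb s) (hZb t))
  have hbG : BddAbove {r : ℝ | ∃ s : ℝ,
      β < F₀ s - Function.leftLim F₀ s ∧ r = |Z s - Function.leftLim Z s|} := by
    refine ⟨(C₁ + C₂) + (C₁ + C₂), ?_⟩
    rintro r ⟨s, _, rfl⟩
    exact (abs_sub _ _).trans (add_le_add (hZb s)
      (le_of_tendsto (hll s).abs (Eventually.of_forall hZb)))
  have D : DS F₀ Z Z₁ Z₂ g (fun x => (eVariationOn g (Iic x)).toReal) μ₀ ζ₁ ζ₂ β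
      (Psi (2 * β) F₀ Z) (bigJump β F₀ Z) (|g 0| + T) T :=
    { Fmono := hFmono, Frc := hFrc, Fbot := hFbot, Ftop := hFtop, hμ := hμ₀, hZ := hZ
      m1 := hZ₁mono, m2 := hZ₂mono, hζ₁ := hζ₁, hζ₂ := hζ₂, grc := hg_rc, hC := hgb
      hv := var_mono g hgTV
      v0 := fun x => ENNReal.toReal_nonneg
      vT := fun x => ENNReal.toReal_mono hgTV (eVariationOn.mono g (subset_univ _))
      hβ := hβ
      hP := fun s t h => le_csSup hbP ⟨s, t, h, rfl⟩
      hG := fun s h => le_csSup hbG ⟨s, h, rfl⟩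
      P0 := Real.sSup_nonneg (by rintro r ⟨s, t, _, rfl⟩; exact abs_nonneg _)
      G0 := Real.sSup_nonneg (by rintro r ⟨s, _, rfl⟩; exact abs_nonneg _) }
  have hgm := rc_measurable g hg_rc
  have hi1 := bdd_integrable ζ₁ g hgm _ hgb
  have hi2 := bdd_integrable ζ₂ g hgm _ hgb
  have hA : Tendsto (fun n : ℕ => -(n : ℝ)) atTop atBot :=
    tendsto_neg_atTop_atBot.comp tendsto_natCast_atTop_atTop
  have hB : Tendsto (fun n : ℕ => (n : ℝ)) atTop atTop := tendsto_natCast_atTop_atTop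
  have hlim := ((intervalIntegral_tendsto_integral hi1 hA hB).sub
    (intervalIntegral_tendsto_integral hi2 hA hB))
  have hL0 : 0 ≤ ∫ t, |g t| ∂μ₀ := integral_nonneg fun _ => abs_nonneg _
  have hT0 : 0 ≤ T := ENNReal.toReal_nonneg
  have hβi : 0 < β⁻¹ := inv_pos.2 hβ
  by_cases hβ1 : 1 ≤ β
  · have hP := D.P0
    have hG := D.G0
    have hF0 : ∀ x, 0 ≤ F₀ x := hFmono.le_of_tendsto hFbot
    have hF1 : ∀ x, F₀ x ≤ 1 := hFmono.ge_of_tendsto hFtop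
    have hz : Tendsto (fun n : ℕ => T * Psi (2 * β) F₀ Z
        + (|g 0| + T) * |Z (n : ℝ) - Z (-(n : ℝ))|) atTop (𝓝 (T * Psi (2 * β) F₀ Z)) := by
      have := ((((hZtop.comp hB).sub (hZbot.comp hA)).abs).const_mul (|g 0| + T)).const_add
        (T * Psi (2 * β) F₀ Z)
      simpa using this
    have hle := le_of_tendsto_of_tendsto' hlim.abs hz (fun n => by
      have hn : -(n : ℝ) ≤ n := by
        have : (0 : ℝ) ≤ n := Nat.cast_nonneg n
        linarith
      have h1 := interval_bound g hg_rc _ hgb _ D.hv Z Z₁ Z₂ hZ hZ₁mono hZ₂mono ζ₁ ζ₂ hζ₁ hζ₂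
        (-(n : ℝ)) n hn (Psi (2 * β) F₀ Z) (fun x _ _ => D.hP _ _ (by
          rw [abs_le]
          constructor <;> linarith [hF0 x, hF1 x, hF0 (-(n : ℝ)), hF1 (-(n : ℝ))]))
      have h2 : |g n * (Z n - Z (-(n : ℝ)))| ≤ (|g 0| + T) * |Z (n : ℝ) - Z (-(n : ℝ))| := by
        rw [abs_mul]
        exact mul_le_mul_of_nonneg_right (hgb _) (abs_nonneg _)
      have h3 := abs_sub_abs_le_abs_sub ((∫ t in (-(n : ℝ))..n, g t ∂ζ₁)
        - (∫ t in (-(n : ℝ))..n, g t ∂ζ₂)) (g n * (Z n - Z (-(n : ℝ))))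
      have h4 := mul_le_mul_of_nonneg_right
        (show (eVariationOn g (Iic (n : ℝ))).toReal - (eVariationOn g (Iic (-(n : ℝ)))).toReal ≤ T by
          linarith [D.vT (n : ℝ), D.v0 (-(n : ℝ))]) hP
      linarith)
    refine hle.trans ?_
    have h5 : 0 ≤ β⁻¹ * (∫ t, |g t| ∂μ₀) * bigJump β F₀ Z := by positivity
    have h6 : 0 ≤ β⁻¹ * (∫ t, |g t| ∂μ₀) * Psi (2 * β) F₀ Z := by positivity
    have h7 : 0 ≤ T * Psi (2 * β) F₀ Z := by positivity
    linarith
  · push Not at hβ1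
    obtain ⟨K, hK⟩ : ∃ K : ℕ, K = ⌈1 / β⌉₊ - 1 := ⟨_, rfl⟩
    have hc1 : 1 < 1 / β := by rw [lt_div_iff₀ hβ]; linarith
    have hc2 : 1 < ⌈1 / β⌉₊ := by rw [Nat.lt_ceil]; simpa using hc1
    have hK' : ⌈1 / β⌉₊ = K + 1 := by omega
    have hlo : (K : ℝ) * β < 1 := by
      rw [← lt_div_iff₀ hβ, ← Nat.lt_ceil]; omega
    have hhi : 1 ≤ ((K : ℝ) + 1) * β := by
      rw [← div_le_iff₀ hβ]
      have := Nat.le_ceil (1 / β)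
      rw [hK'] at this
      exact_mod_cast this
    refine le_of_tendsto hlim.abs ?_
    filter_upwards [hA.eventually (eventually_le_atBot (Qf F₀ β)),
      hB.eventually (eventually_ge_atTop (Qf F₀ (K * β)))] with n h1 h2
    exact D.finite_bound K (by omega) hlo hhi _ _ h1 h2
end

section
/- Let F₀ be a distribution function, β > 0, and let s₁ < s₂ < … < s_M be real numbers satisfying F₀(s₁⁻) ≤ 2β, F₀(s_j⁻) − F₀(s_{j−1}) ≤ 2β for 2 ≤ j ≤ M, and 1 − F₀(s_M) ≤ 2β. Let Z : ℝ → ℝ be a bounded function with Z(t) → 0 as t → ±∞, and define the step approximation Z̃ : ℝ → ℝ by Z̃(x) = Z(s_{j−1}) for x ∈ [s_{j−1}, s_j) (2 ≤ j ≤ M) and Z̃(x) = 0 for x < s₁ and for x ≥ s_M. Then sup_{x ∈ ℝ} |Z(x) − Z̃(x)| ≤ Ψ_{2β,F₀}(Z). -/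
open MeasureTheory Filter Topology Set Function

/-- **Grid approximation bound (display 'SupB').** If `s₁ < … < s_M` is a grid with
`F₀(s₁⁻) ≤ 2β`, `F₀(s_j⁻) - F₀(s_{j-1}) ≤ 2β` and `1 - F₀(s_M) ≤ 2β`, and `Z̃` is the step
approximation of a bounded `Z` vanishing at `±∞` (equal to `Z(s_{j-1})` on `[s_{j-1}, s_j)`
and `0` outside `[s₁, s_M)`), then `sup_x |Z(x) - Z̃(x)| ≤ Ψ_{2β,F₀}(Z)`. -/
theorem grid_approximation_bound
    (F₀ : ℝ → ℝ) (hFmono : Monotone F₀)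
    (hFrc : ∀ t, ContinuousWithinAt F₀ (Set.Ici t) t)
    (hFbot : Tendsto F₀ atBot (nhds 0)) (hFtop : Tendsto F₀ atTop (nhds 1))
    (β : ℝ) (hβ : 0 < β)
    (M : ℕ) (hM : 1 ≤ M) (s : ℕ → ℝ)
    (hs : ∀ i j : ℕ, 1 ≤ i → i < j → j ≤ M → s i < s j)
    (hgrid₁ : Function.leftLim F₀ (s 1) ≤ 2 * β)
    (hgrid₂ : ∀ j : ℕ, 2 ≤ j → j ≤ M →
      Function.leftLim F₀ (s j) - F₀ (s (j - 1)) ≤ 2 * β)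
    (hgrid₃ : 1 - F₀ (s M) ≤ 2 * β)
    (Z : ℝ → ℝ) (hZb : ∃ C, ∀ t, |Z t| ≤ C)
    (hZbot : Tendsto Z atBot (nhds 0)) (hZtop : Tendsto Z atTop (nhds 0))
    (Zt : ℝ → ℝ)
    (hZt₁ : ∀ t : ℝ, t < s 1 → Zt t = 0)
    (hZt₂ : ∀ t : ℝ, s M ≤ t → Zt t = 0)
    (hZt₃ : ∀ j : ℕ, 2 ≤ j → j ≤ M →
      ∀ t : ℝ, s (j - 1) ≤ t → t < s j → Zt t = Z (s (j - 1))) :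
    ⨆ t : ℝ, |Z t - Zt t| ≤ Psi (2 * β) F₀ Z := by
  obtain ⟨C, hC⟩ := hZb
  have hbdd : BddAbove {r : ℝ | ∃ s t : ℝ, |F₀ s - F₀ t| ≤ 2 * β ∧ r = |Z s - Z t|} := by
    refine ⟨C + C, ?_⟩
    rintro r ⟨a, b, -, rfl⟩
    exact (abs_sub _ _).trans (add_le_add (hC a) (hC b))
  have key : ∀ a b : ℝ, |F₀ a - F₀ b| ≤ 2 * β → |Z a - Z b| ≤ Psi (2 * β) F₀ Z :=
    fun a b h => le_csSup hbdd ⟨a, b, h, rfl⟩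
  have h0 : ∀ a, 0 ≤ F₀ a := fun a => hFmono.le_of_tendsto hFbot a
  have h1 : ∀ a, F₀ a ≤ 1 := fun a => hFmono.ge_of_tendsto hFtop a
  refine ciSup_le fun t => ?_
  by_cases ht1 : t < s 1
  · rw [hZt₁ t ht1]
    have hF : F₀ t ≤ 2 * β := (hFmono.le_leftLim ht1).trans hgrid₁
    have hlim : Tendsto (fun y => |Z t - Z y|) atBot (nhds |Z t - 0|) :=
      (tendsto_const_nhds.sub hZbot).abs
    refine le_of_tendsto hlim ?_
    filter_upwards [eventually_le_atBot t] with y hy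
    refine key t y ?_
    have := hFmono hy
    have := h0 y
    rw [abs_le]; constructor <;> linarith
  by_cases ht2 : s M ≤ t
  · rw [hZt₂ t ht2]
    have hlim : Tendsto (fun y => |Z t - Z y|) atTop (nhds |Z t - 0|) :=
      (tendsto_const_nhds.sub hZtop).abs
    refine le_of_tendsto hlim ?_
    filter_upwards [eventually_ge_atTop t] with y hy
    refine key t y ?_
    have := hFmono hy
    have := hFmono ht2
    have := h1 y
    rw [abs_le]; constructor <;> linarith
  push Not at ht1 ht2
  classical
  have hex : ∃ j, 1 ≤ j ∧ t < s j := ⟨M, hM, ht2⟩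
  obtain ⟨hj1, hjt⟩ := Nat.find_spec hex
  have hjM : Nat.find hex ≤ M := Nat.find_min' hex ⟨hM, ht2⟩
  have hmin := fun m (hm : m < Nat.find hex) => Nat.find_min hex hm
  generalize Nat.find hex = j at *
  have hj2 : 2 ≤ j := by
    by_contra hlt
    have : j = 1 := by omega
    subst this
    linarith
  have hle : s (j - 1) ≤ t := by
    by_contra hlt
    exact hmin (j - 1) (by omega) ⟨by omega, not_le.mp hlt⟩
  rw [hZt₃ j hj2 hjM t hle hjt]
  refine key _ _ ?_
  have := hFmono hle
  have := hFmono.le_leftLim hjt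
  have := hgrid₂ j hj2 hjM
  rw [abs_le]; constructor <;> linarith
end

section
/- Let F₀ be a distribution function with Lebesgue–Stieltjes probability measure μ₀, let β > 0, and let s₀ < s₁ < … < s_M be real numbers with F₀(s_j) − F₀(s_{j−1}) ≥ β for 1 ≤ j ≤ M. Then for every Borel measurable g : ℝ → ℝ of finite total variation, ∑_{j=1}^M |g(s_j)| ≤ 2‖g‖_TV + β^{−1} ∫ |g| dμ₀. -/
open MeasureTheory Filter Topology Set Function

/-- **Grid-value bound (used in display (5)).** If `s₀ < s₁ < … < s_M` satisfies
`F₀(s_j) - F₀(s_{j-1}) ≥ β` for `1 ≤ j ≤ M`, then for every Borel `g` of finite total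
variation, `∑_{j=1}^M |g(s_j)| ≤ 2‖g‖_TV + β⁻¹ ∫ |g| dμ₀`. -/
theorem sum_grid_values_bound
    (F₀ : ℝ → ℝ) (hFmono : Monotone F₀)
    (hFrc : ∀ t, ContinuousWithinAt F₀ (Set.Ici t) t)
    (hFbot : Tendsto F₀ atBot (nhds 0)) (hFtop : Tendsto F₀ atTop (nhds 1))
    (μ₀ : Measure ℝ) [IsProbabilityMeasure μ₀]
    (hμ₀ : ∀ a b : ℝ, a ≤ b → μ₀ (Set.Ioc a b) = ENNReal.ofReal (F₀ b - F₀ a))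
    (β : ℝ) (hβ : 0 < β)
    (M : ℕ) (s : ℕ → ℝ)
    (hs : ∀ i j : ℕ, i < j → j ≤ M → s i < s j)
    (hgap : ∀ j : ℕ, 1 ≤ j → j ≤ M → β ≤ F₀ (s j) - F₀ (s (j - 1)))
    (g : ℝ → ℝ) (hgm : Measurable g) (hgTV : eVariationOn g Set.univ ≠ ⊤) :
    ∑ j ∈ Finset.Icc 1 M, |g (s j)|
      ≤ 2 * (eVariationOn g Set.univ).toReal + β⁻¹ * ∫ t, |g t| ∂μ₀ := by
  have hbv : BoundedVariationOn g Set.univ := hgTV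
  have hbvs : ∀ S : Set ℝ, BoundedVariationOn g S := fun S => hbv.mono (Set.subset_univ S)
  have hint : Integrable (fun t => |g t|) μ₀ := by
    refine Integrable.of_bound (C := |g 0| + (eVariationOn g Set.univ).toReal)
      hgm.abs.aestronglyMeasurable (Filter.Eventually.of_forall fun t => ?_)
    have h := hbv.dist_le (Set.mem_univ t) (Set.mem_univ 0)
    rw [Real.dist_eq] at h
    have h2 := abs_sub_abs_le_abs_sub (g t) (g 0)
    rw [Real.norm_eq_abs, abs_abs]
    linarith
  have step : ∀ a b : ℝ, a ≤ b → β ≤ F₀ b - F₀ a →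
      |g b| ≤ (eVariationOn g (Set.Icc a b)).toReal + β⁻¹ * ∫ t in Set.Ioc a b, |g t| ∂μ₀ := by
    intro a b hab hg
    set V := (eVariationOn g (Set.Icc a b)).toReal with hV
    have hI : 0 ≤ ∫ t in Set.Ioc a b, |g t| ∂μ₀ := integral_nonneg fun t => abs_nonneg _
    have hm : μ₀.real (Set.Ioc a b) = F₀ b - F₀ a := by
      rw [Measure.real, hμ₀ a b hab, ENNReal.toReal_ofReal (by linarith)]
    by_cases hc : |g b| - V ≤ 0
    · have : 0 ≤ β⁻¹ * ∫ t in Set.Ioc a b, |g t| ∂μ₀ := by positivity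
      linarith
    push Not at hc
    have h1 : ∫ t in Set.Ioc a b, (|g b| - V) ∂μ₀ ≤ ∫ t in Set.Ioc a b, |g t| ∂μ₀ := by
      refine setIntegral_mono_on (integrable_const _) hint.integrableOn measurableSet_Ioc ?_
      intro t ht
      have h := (hbvs (Set.Icc a b)).dist_le (Set.right_mem_Icc.2 hab) (Set.Ioc_subset_Icc_self ht)
      rw [Real.dist_eq] at h
      have h2 := abs_sub_abs_le_abs_sub (g b) (g t)
      linarith
    rw [setIntegral_const, hm, smul_eq_mul] at h1
    have h3 : β * (|g b| - V) ≤ ∫ t in Set.Ioc a b, |g t| ∂μ₀ :=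
      (mul_le_mul_of_nonneg_right hg hc.le).trans h1
    have h4 := mul_le_mul_of_nonneg_left h3 (inv_pos.2 hβ).le
    rw [inv_mul_cancel_left₀ hβ.ne'] at h4
    linarith
  have key : ∀ n : ℕ, n ≤ M → s 0 ≤ s n ∧ ∑ j ∈ Finset.Icc 1 n, |g (s j)|
      ≤ (eVariationOn g (Set.Icc (s 0) (s n))).toReal
        + β⁻¹ * ∫ t in Set.Ioc (s 0) (s n), |g t| ∂μ₀ := by
    intro n
    induction n with
    | zero =>
      intro _
      simp
    | succ n ih =>
      intro hn
      obtain ⟨h0, ih⟩ := ih (by omega)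
      have h1 : s n ≤ s (n+1) := (hs n (n+1) (by omega) hn).le
      refine ⟨h0.trans h1, ?_⟩
      have hst := step (s n) (s (n+1)) h1 (by simpa using hgap (n+1) (by omega) hn)
      have hv := eVariationOn.Icc_add_Icc g (s := Set.univ) h0 h1 (Set.mem_univ _)
      simp only [Set.univ_inter] at hv
      rw [Finset.sum_Icc_succ_top (by omega), ← hv, ENNReal.toReal_add (hbvs _) (hbvs _),
        ← Set.Ioc_union_Ioc_eq_Ioc h0 h1, setIntegral_union (Set.Ioc_disjoint_Ioc_of_le le_rfl)
          measurableSet_Ioc hint.integrableOn hint.integrableOn, mul_add]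
      linarith
  obtain ⟨_, h⟩ := key M le_rfl
  have e1 : (eVariationOn g (Set.Icc (s 0) (s M))).toReal ≤ (eVariationOn g Set.univ).toReal :=
    ENNReal.toReal_mono hgTV (eVariationOn.mono g (Set.subset_univ _))
  have e2 : ∫ t in Set.Ioc (s 0) (s M), |g t| ∂μ₀ ≤ ∫ t, |g t| ∂μ₀ :=
    setIntegral_le_integral hint (Filter.Eventually.of_forall fun t => abs_nonneg _)
  have e3 := mul_le_mul_of_nonneg_left e2 (inv_pos.2 hβ).le
  have e4 : 0 ≤ (eVariationOn g Set.univ).toReal := ENNReal.toReal_nonneg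
  linarith
end

section
/- Let F₀ be a distribution function with Lebesgue–Stieltjes probability measure μ₀, let β > 0, and let s₀ < s₁ < … < s_M be real numbers with F₀(s_j) − F₀(s_{j−1}) ≥ β and F₀(s_j⁻) − F₀(s_{j−1}) ≤ 2β for 1 ≤ j ≤ M. Let Z : ℝ → ℝ be bounded and possess a left limit Z(s⁻) at every s ∈ ℝ, and let g : ℝ → ℝ be Borel measurable of finite total variation. Then |∑_{j=1}^M g(s_j)·(Z(s_j⁻) − Z(s_{j−1}))| ≤ Ψ_{2β,F₀}(Z)·( ‖g‖_TV + β^{−1} ∫ |g| dμ₀ ). -/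
open MeasureTheory Filter Topology Set Function

lemma psi_le (β : ℝ) (F₀ Z : ℝ → ℝ) (hZb : ∃ C, ∀ t, |Z t| ≤ C) (a b : ℝ)
    (h : |F₀ a - F₀ b| ≤ β) : |Z a - Z b| ≤ Psi β F₀ Z := by
  obtain ⟨C, hC⟩ := hZb
  apply le_csSup
  · refine ⟨C + C, ?_⟩
    rintro r ⟨x, y, -, rfl⟩
    exact (abs_sub _ _).trans (add_le_add (hC x) (hC y))
  · exact ⟨a, b, h, rfl⟩

lemma step_bound (F₀ : ℝ → ℝ) (μ₀ : Measure ℝ) [IsProbabilityMeasure μ₀]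
    (hμ₀ : ∀ a b : ℝ, a ≤ b → μ₀ (Set.Ioc a b) = ENNReal.ofReal (F₀ b - F₀ a))
    (β : ℝ) (hβ : 0 < β) (g : ℝ → ℝ) (hgTV : eVariationOn g Set.univ ≠ ⊤)
    (hi : Integrable g μ₀) (a b : ℝ) (hab : a < b) (hgap : β ≤ F₀ b - F₀ a) :
    |g b| ≤ (eVariationOn g (Icc a b)).toReal + β⁻¹ * ∫ t in Ioc a b, |g t| ∂μ₀ := by
  set V := (eVariationOn g (Icc a b)).toReal with hV
  have hfin : eVariationOn g (Icc a b) ≠ ⊤ :=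
    ne_top_of_le_ne_top hgTV (eVariationOn.mono g (subset_univ _))
  have h1 : ∀ t ∈ Ioc a b, |g b| - V ≤ |g t| := by
    intro t ht
    have h2 := eVariationOn.edist_le g (show b ∈ Icc a b from ⟨hab.le, le_rfl⟩)
      (show t ∈ Icc a b from ⟨ht.1.le, ht.2⟩)
    have h3 := ENNReal.toReal_mono hfin h2
    rw [edist_dist, ENNReal.toReal_ofReal dist_nonneg, Real.dist_eq] at h3
    have := abs_sub_abs_le_abs_sub (g b) (g t)
    linarith
  have h4 : ∫ t in Ioc a b, (|g b| - V) ∂μ₀ ≤ ∫ t in Ioc a b, |g t| ∂μ₀ := by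
    apply setIntegral_mono_on _ hi.abs.integrableOn measurableSet_Ioc h1
    exact integrableOn_const (measure_ne_top _ _)
  have hm : μ₀.real (Ioc a b) = F₀ b - F₀ a := by
    rw [Measure.real, hμ₀ a b hab.le, ENNReal.toReal_ofReal (by linarith)]
  rw [setIntegral_const, hm, smul_eq_mul] at h4
  have h5 : 0 ≤ ∫ t in Ioc a b, |g t| ∂μ₀ := integral_nonneg fun _ => abs_nonneg _
  have h6 : β * (|g b| - V) ≤ ∫ t in Ioc a b, |g t| ∂μ₀ := by
    by_cases h : 0 ≤ |g b| - V
    · exact (mul_le_mul_of_nonneg_right hgap h).trans h4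
    · push Not at h
      nlinarith
  have h7 : |g b| - V ≤ β⁻¹ * ∫ t in Ioc a b, |g t| ∂μ₀ := by
    rw [le_inv_mul_iff₀ hβ]; exact h6
  linarith

/-- **Display (4), 'Comp1'.** If `s₀ < s₁ < … < s_M` satisfies `F₀(s_j) - F₀(s_{j-1}) ≥ β`
and `F₀(s_j⁻) - F₀(s_{j-1}) ≤ 2β` for `1 ≤ j ≤ M`, `Z` is bounded with left limits
everywhere, and `g` is Borel of finite total variation, then
`|∑_{j=1}^M g(s_j)(Z(s_j⁻) - Z(s_{j-1}))| ≤ Ψ_{2β,F₀}(Z)·(‖g‖_TV + β⁻¹ ∫ |g| dμ₀)`. -/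
theorem comp1_bound
    (F₀ : ℝ → ℝ) (hFmono : Monotone F₀)
    (hFrc : ∀ t, ContinuousWithinAt F₀ (Set.Ici t) t)
    (hFbot : Tendsto F₀ atBot (nhds 0)) (hFtop : Tendsto F₀ atTop (nhds 1))
    (μ₀ : Measure ℝ) [IsProbabilityMeasure μ₀]
    (hμ₀ : ∀ a b : ℝ, a ≤ b → μ₀ (Set.Ioc a b) = ENNReal.ofReal (F₀ b - F₀ a))
    (β : ℝ) (hβ : 0 < β)
    (M : ℕ) (s : ℕ → ℝ)
    (hs : ∀ i j : ℕ, i < j → j ≤ M → s i < s j)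
    (hgap : ∀ j : ℕ, 1 ≤ j → j ≤ M → β ≤ F₀ (s j) - F₀ (s (j - 1)))
    (hgap2 : ∀ j : ℕ, 1 ≤ j → j ≤ M →
      Function.leftLim F₀ (s j) - F₀ (s (j - 1)) ≤ 2 * β)
    (Z : ℝ → ℝ) (hZb : ∃ C, ∀ t, |Z t| ≤ C)
    (hZl : ∀ t : ℝ, Tendsto Z (nhdsWithin t (Set.Iio t)) (nhds (Function.leftLim Z t)))
    (g : ℝ → ℝ) (hgm : Measurable g) (hgTV : eVariationOn g Set.univ ≠ ⊤) :
    |∑ j ∈ Finset.Icc 1 M, g (s j) * (Function.leftLim Z (s j) - Z (s (j - 1)))|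
      ≤ Psi (2 * β) F₀ Z
          * ((eVariationOn g Set.univ).toReal + β⁻¹ * ∫ t, |g t| ∂μ₀) := by
  have hfin : ∀ A : Set ℝ, eVariationOn g A ≠ ⊤ := fun A =>
    ne_top_of_le_ne_top hgTV (eVariationOn.mono g (subset_univ _))
  have hi : Integrable g μ₀ := by
    refine Integrable.of_bound (C := |g 0| + (eVariationOn g univ).toReal)
      hgm.aestronglyMeasurable (Eventually.of_forall fun t => ?_)
    have h3 := ENNReal.toReal_mono hgTV (eVariationOn.edist_le g (mem_univ t) (mem_univ 0))
    rw [edist_dist, ENNReal.toReal_ofReal dist_nonneg, Real.dist_eq] at h3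
    have := abs_sub_abs_le_abs_sub (g t) (g 0)
    rw [Real.norm_eq_abs]
    linarith
  have hΨ : 0 ≤ Psi (2 * β) F₀ Z :=
    (abs_nonneg _).trans (psi_le (2 * β) F₀ Z hZb 0 0 (by simp [hβ.le]))
  have key : ∀ n : ℕ, n ≤ M → ∑ j ∈ Finset.Icc 1 n, |g (s j)| ≤
      (eVariationOn g (Icc (s 0) (s n))).toReal
        + β⁻¹ * ∫ t in Ioc (s 0) (s n), |g t| ∂μ₀ := by
    intro n
    induction n with
    | zero => intro _; simp
    | succ n ih =>
      intro hn
      have h1 := ih (by omega)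
      have hlt : s n < s (n + 1) := hs n (n + 1) (by omega) hn
      have h0 : s 0 ≤ s n := by
        rcases Nat.eq_zero_or_pos n with h | h
        · rw [h]
        · exact (hs 0 n h (by omega)).le
      have h2 := step_bound F₀ μ₀ hμ₀ β hβ g hgTV hi (s n) (s (n + 1)) hlt
        (by simpa using hgap (n + 1) (by omega) hn)
      have h3 := eVariationOn.Icc_add_Icc g (s := univ) h0 hlt.le (mem_univ _)
      simp only [univ_inter] at h3
      have h4 : ∫ t in Ioc (s 0) (s (n + 1)), |g t| ∂μ₀
          = (∫ t in Ioc (s 0) (s n), |g t| ∂μ₀) + ∫ t in Ioc (s n) (s (n + 1)), |g t| ∂μ₀ := by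
        rw [← Ioc_union_Ioc_eq_Ioc h0 hlt.le]
        exact setIntegral_union (Ioc_disjoint_Ioc_of_le le_rfl) measurableSet_Ioc
          hi.abs.integrableOn hi.abs.integrableOn
      rw [Finset.sum_Icc_succ_top (by omega), ← h3, ENNReal.toReal_add (hfin _) (hfin _), h4,
        mul_add]
      linarith
  have hterm : ∀ j ∈ Finset.Icc 1 M,
      |g (s j) * (Function.leftLim Z (s j) - Z (s (j - 1)))| ≤ Psi (2 * β) F₀ Z * |g (s j)| := by
    intro j hj
    rw [Finset.mem_Icc] at hj
    have hlt : s (j - 1) < s j := hs (j - 1) j (by omega) hj.2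
    rw [abs_mul, mul_comm]
    refine mul_le_mul_of_nonneg_right ?_ (abs_nonneg _)
    have ht := ((hZl (s j)).sub_const (Z (s (j - 1)))).abs
    refine le_of_tendsto ht ?_
    filter_upwards [Ioo_mem_nhdsLT hlt] with t ht
    apply psi_le _ _ _ hZb
    have h1 := hFmono.le_leftLim ht.2
    have h2 := hFmono ht.1.le
    have h3 := hgap2 j hj.1 hj.2
    rw [abs_of_nonneg (by linarith)]
    linarith
  calc _ ≤ ∑ j ∈ Finset.Icc 1 M, |g (s j) * (Function.leftLim Z (s j) - Z (s (j - 1)))| :=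
        Finset.abs_sum_le_sum_abs _ _
    _ ≤ ∑ j ∈ Finset.Icc 1 M, Psi (2 * β) F₀ Z * |g (s j)| := Finset.sum_le_sum hterm
    _ = Psi (2 * β) F₀ Z * ∑ j ∈ Finset.Icc 1 M, |g (s j)| := by rw [Finset.mul_sum]
    _ ≤ _ := by
      refine mul_le_mul_of_nonneg_left ((key M le_rfl).trans ?_) hΨ
      refine add_le_add (ENNReal.toReal_mono hgTV (eVariationOn.mono g (subset_univ _))) ?_
      refine mul_le_mul_of_nonneg_left ?_ (inv_nonneg.2 hβ.le)
      exact setIntegral_le_integral hi.abs (Eventually.of_forall fun _ => abs_nonneg _)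
end

section
/- Let F₀ be a distribution function with Lebesgue–Stieltjes probability measure μ₀, let β > 0, and let s₀ < s₁ < … < s_M be real numbers with F₀(s_j) − F₀(s_{j−1}) ≥ β for 1 ≤ j ≤ M. Let Z : ℝ → ℝ be bounded and possess a left limit Z(s⁻) at every s ∈ ℝ, and let g : ℝ → ℝ be Borel measurable of finite total variation. Then |∑_{j=1}^M g(s_j)·(Z(s_j) − Z(s_j⁻))| ≤ Ψ_{2β,F₀}(Z)·( 2‖g‖_TV + β^{−1} ∫ |g| dμ₀ ) + 𝔤_{β,F₀}(Z)·β^{−1} ∫ |g| dμ₀. -/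
open MeasureTheory Filter Topology Set Function

theorem aux_var (g : ℝ → ℝ) (s : ℕ → ℝ) (M : ℕ) (hs : ∀ i j : ℕ, i < j → j ≤ M → s i < s j) (n : ℕ)
    (hn : n ≤ M) : ∑ k ∈ Finset.range n, eVariationOn g (Icc (s k) (s (k+1)))
      ≤ eVariationOn g (Icc (s 0) (s n)) := by
  induction n with
  | zero => simp
  | succ n ih =>
    rw [Finset.sum_range_succ]
    have h0 : s 0 ≤ s n := by
      rcases Nat.eq_zero_or_pos n with h | h
      · subst h; exact le_rfl
      · exact (hs 0 n h (by omega)).le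
    have h1 : s n ≤ s (n+1) := (hs n (n+1) (by omega) hn).le
    have := eVariationOn.Icc_add_Icc g (s := univ) h0 h1 (mem_univ _)
    simp only [univ_inter] at this
    rw [← this]
    gcongr
    exact ih (by omega)

/-- **Display (5).** If `s₀ < s₁ < … < s_M` satisfies `F₀(s_j) - F₀(s_{j-1}) ≥ β` for
`1 ≤ j ≤ M`, `Z` is bounded with left limits everywhere, and `g` is Borel of finite total
variation, then `|∑_{j=1}^M g(s_j)(Z(s_j) - Z(s_j⁻))|
  ≤ Ψ_{2β,F₀}(Z)·(2‖g‖_TV + β⁻¹ ∫ |g| dμ₀) + 𝔤_{β,F₀}(Z)·β⁻¹ ∫ |g| dμ₀`. -/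
theorem grid_jump_bound
    (F₀ : ℝ → ℝ) (hFmono : Monotone F₀)
    (hFrc : ∀ t, ContinuousWithinAt F₀ (Set.Ici t) t)
    (hFbot : Tendsto F₀ atBot (nhds 0)) (hFtop : Tendsto F₀ atTop (nhds 1))
    (μ₀ : Measure ℝ) [IsProbabilityMeasure μ₀]
    (hμ₀ : ∀ a b : ℝ, a ≤ b → μ₀ (Set.Ioc a b) = ENNReal.ofReal (F₀ b - F₀ a))
    (β : ℝ) (hβ : 0 < β)
    (M : ℕ) (s : ℕ → ℝ)
    (hs : ∀ i j : ℕ, i < j → j ≤ M → s i < s j)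
    (hgap : ∀ j : ℕ, 1 ≤ j → j ≤ M → β ≤ F₀ (s j) - F₀ (s (j - 1)))
    (Z : ℝ → ℝ) (hZb : ∃ C, ∀ t, |Z t| ≤ C)
    (hZl : ∀ t : ℝ, Tendsto Z (nhdsWithin t (Set.Iio t)) (nhds (Function.leftLim Z t)))
    (g : ℝ → ℝ) (hgm : Measurable g) (hgTV : eVariationOn g Set.univ ≠ ⊤) :
    |∑ j ∈ Finset.Icc 1 M, g (s j) * (Z (s j) - Function.leftLim Z (s j))|
      ≤ Psi (2 * β) F₀ Z
            * (2 * (eVariationOn g Set.univ).toReal + β⁻¹ * ∫ t, |g t| ∂μ₀)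
        + bigJump β F₀ Z * (β⁻¹ * ∫ t, |g t| ∂μ₀) := by
  obtain ⟨C, hC⟩ := hZb
  have hbv : BoundedVariationOn g univ := hgTV
  have hLC : ∀ t, |leftLim Z t| ≤ C := fun t =>
    le_of_tendsto (hZl t).abs (Eventually.of_forall hC)
  have hPbdd : BddAbove {r : ℝ | ∃ s t : ℝ, |F₀ s - F₀ t| ≤ 2 * β ∧ r = |Z s - Z t|} := by
    refine ⟨2 * C, ?_⟩
    rintro r ⟨a, b, -, rfl⟩
    have := abs_sub (Z a) (Z b)
    linarith [hC a, hC b]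
  have hGbdd : BddAbove {r : ℝ | ∃ s : ℝ,
    β < F₀ s - Function.leftLim F₀ s ∧ r = |Z s - Function.leftLim Z s|} := by
    refine ⟨2 * C, ?_⟩
    rintro r ⟨a, -, rfl⟩
    have := abs_sub (Z a) (leftLim Z a)
    linarith [hC a, hLC a]
  have hP0 : 0 ≤ Psi (2 * β) F₀ Z := by
    apply Real.sSup_nonneg
    rintro r ⟨a, b, -, rfl⟩
    exact abs_nonneg _
  have hG0 : 0 ≤ bigJump β F₀ Z := by
    apply Real.sSup_nonneg
    rintro r ⟨a, -, rfl⟩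
    exact abs_nonneg _
  have hsmall : ∀ x, F₀ x - leftLim F₀ x ≤ β → |Z x - leftLim Z x| ≤ Psi (2 * β) F₀ Z := by
    intro x hx
    have ht : Tendsto (fun y => |Z x - Z y|) (𝓝[<] x) (𝓝 |Z x - leftLim Z x|) :=
      (tendsto_const_nhds.sub (hZl x)).abs
    refine le_of_tendsto ht ?_
    have h1 : ∀ᶠ y in 𝓝[<] x, leftLim F₀ x - β < F₀ y :=
      (hFmono.tendsto_leftLim x).eventually (lt_mem_nhds (by linarith))
    filter_upwards [h1, self_mem_nhdsWithin] with y hy hyx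
    refine le_csSup hPbdd ⟨x, y, ?_, rfl⟩
    have := hFmono (le_of_lt hyx)
    rw [abs_of_nonneg (by linarith)]
    linarith
  have hbig : ∀ x, β < F₀ x - leftLim F₀ x → |Z x - leftLim Z x| ≤ bigJump β F₀ Z :=
    fun x hx => le_csSup hGbdd ⟨x, hx, rfl⟩
  have hsing : ∀ x, μ₀.real {x} = F₀ x - leftLim F₀ x := by
    intro x
    let S : StieltjesFunction ℝ := ⟨F₀, hFmono, hFrc⟩
    have hS : μ₀ = S.measure := by
      apply Measure.ext_of_Ioc
      intro a b hab
      rw [hμ₀ a b hab.le, S.measure_Ioc]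
    have h2 : μ₀ {x} = ENNReal.ofReal (F₀ x - leftLim F₀ x) := by
      rw [hS, S.measure_singleton]
    rw [Measure.real, h2, ENNReal.toReal_ofReal]
    linarith [hFmono.leftLim_le (le_refl x)]
  have hint : Integrable (fun t => |g t|) μ₀ := by
    refine Integrable.of_bound (C := |g 0| + (eVariationOn g univ).toReal)
      hgm.abs.aestronglyMeasurable (Eventually.of_forall fun t => ?_)
    have := hbv.dist_le (mem_univ t) (mem_univ 0)
    rw [Real.dist_eq] at this
    have h3 := abs_sub_abs_le_abs_sub (g t) (g 0)
    simp only [Real.norm_eq_abs, abs_abs]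
    linarith
  have hlt : ∀ k, k < M → s k < s (k+1) := fun k hk => hs k (k+1) (by omega) hk
  have hVfin : ∀ a b, eVariationOn g (Icc a b) ≠ ⊤ := fun a b =>
    ne_top_of_le_ne_top hgTV (eVariationOn.mono g (subset_univ _))
  have hterm : ∀ k ∈ Finset.range M,
      |g (s (k+1)) * (Z (s (k+1)) - leftLim Z (s (k+1)))| ≤
      Psi (2 * β) F₀ Z * ((eVariationOn g (Icc (s k) (s (k+1)))).toReal
        + β⁻¹ * ∫ t in Ioc (s k) (s (k+1)), |g t| ∂μ₀)
      + bigJump β F₀ Z * (β⁻¹ * ∫ t in Ioc (s k) (s (k+1)), |g t| ∂μ₀) := by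
    intro k hk
    rw [Finset.mem_range] at hk
    have hk1 := hlt k hk
    set a := s k
    set b := s (k+1)
    set V := (eVariationOn g (Icc a b)).toReal with hV
    have hV0 : 0 ≤ V := ENNReal.toReal_nonneg
    have hA0 : 0 ≤ ∫ t in Ioc a b, |g t| ∂μ₀ := integral_nonneg fun t => abs_nonneg _
    have hβA : 0 ≤ β⁻¹ * ∫ t in Ioc a b, |g t| ∂μ₀ := mul_nonneg (inv_nonneg.2 hβ.le) hA0
    rw [abs_mul]
    by_cases hj : β < F₀ b - leftLim F₀ b
    · have h1 : |g b| ≤ β⁻¹ * ∫ t in Ioc a b, |g t| ∂μ₀ := by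
        rw [inv_mul_eq_div, le_div_iff₀ hβ]
        have h2 : ∫ t in ({b} : Set ℝ), |g t| ∂μ₀ ≤ ∫ t in Ioc a b, |g t| ∂μ₀ :=
          setIntegral_mono_set hint.integrableOn (Eventually.of_forall fun t => abs_nonneg _)
            (HasSubset.Subset.eventuallyLE (by
              rintro _ rfl
              exact ⟨hk1, le_rfl⟩))
        rw [integral_singleton, hsing b, smul_eq_mul] at h2
        nlinarith [abs_nonneg (g b)]
      have h3 := mul_le_mul h1 (hbig b hj) (abs_nonneg _) hβA
      have h4 := mul_nonneg hP0 (add_nonneg hV0 hβA)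
      linarith
    · have h1 : |g b| ≤ V + β⁻¹ * ∫ t in Ioc a b, |g t| ∂μ₀ := by
        by_cases hc : |g b| ≤ V
        · linarith
        push Not at hc
        have h2 : ∫ t in Ioc a b, (|g b| - V) ∂μ₀ ≤ ∫ t in Ioc a b, |g t| ∂μ₀ := by
          refine setIntegral_mono_on (integrable_const _) hint.integrableOn
            measurableSet_Ioc fun t ht => ?_
          have hb : BoundedVariationOn g (Icc a b) := hVfin a b
          have h5 := hb.dist_le (x := b) (y := t) ⟨hk1.le, le_rfl⟩ ⟨ht.1.le, ht.2⟩
          rw [Real.dist_eq] at h5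
          have h6 := abs_sub_abs_le_abs_sub (g b) (g t)
          linarith
        have h7 : β ≤ F₀ b - F₀ a := hgap (k+1) (by omega) (by omega)
        have h8 : μ₀.real (Ioc a b) = F₀ b - F₀ a := by
          rw [Measure.real, hμ₀ a b hk1.le, ENNReal.toReal_ofReal (by linarith)]
        rw [setIntegral_const, h8, smul_eq_mul] at h2
        have h9 : |g b| - V ≤ β⁻¹ * ∫ t in Ioc a b, |g t| ∂μ₀ := by
          rw [inv_mul_eq_div, le_div_iff₀ hβ]
          nlinarith
        linarith
      have h3 := mul_le_mul h1 (hsmall b (not_lt.1 hj)) (abs_nonneg _) (add_nonneg hV0 hβA)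
      have h4 := mul_nonneg hG0 hβA
      linarith
  have hsumV : ∑ k ∈ Finset.range M, (eVariationOn g (Icc (s k) (s (k+1)))).toReal
      ≤ (eVariationOn g univ).toReal := by
    rw [← ENNReal.toReal_sum fun k _ => hVfin _ _]
    exact ENNReal.toReal_mono hgTV
      ((aux_var g s M hs M le_rfl).trans (eVariationOn.mono g (subset_univ _)))
  have hsumA : ∑ k ∈ Finset.range M, ∫ t in Ioc (s k) (s (k+1)), |g t| ∂μ₀
      ≤ ∫ t, |g t| ∂μ₀ := by
    have h1 : ∀ k ∈ Finset.range M, ∫ t in Ioc (s k) (s (k+1)), |g t| ∂μ₀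
        = ∫ t in (s k)..(s (k+1)), |g t| ∂μ₀ := fun k hk =>
      (intervalIntegral.integral_of_le (hlt k (Finset.mem_range.1 hk)).le).symm
    have h0 : s 0 ≤ s M := by
      rcases Nat.eq_zero_or_pos M with h | h
      · rw [h]
      · exact (hs 0 M h le_rfl).le
    rw [Finset.sum_congr rfl h1, intervalIntegral.sum_integral_adjacent_intervals
      (fun k _ => hint.intervalIntegrable), intervalIntegral.integral_of_le h0]
    exact setIntegral_le_integral hint (Eventually.of_forall fun t => abs_nonneg _)
  have hre : ∑ j ∈ Finset.Icc 1 M, g (s j) * (Z (s j) - leftLim Z (s j))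
      = ∑ k ∈ Finset.range M, g (s (k+1)) * (Z (s (k+1)) - leftLim Z (s (k+1))) := by
    rw [Finset.range_eq_Ico, Finset.sum_Ico_add' (fun j => g (s j) * (Z (s j) - leftLim Z (s j)))]
    rfl
  rw [hre]
  refine (Finset.abs_sum_le_sum_abs _ _).trans ((Finset.sum_le_sum hterm).trans ?_)
  rw [Finset.sum_add_distrib, ← Finset.mul_sum, ← Finset.mul_sum, Finset.sum_add_distrib,
    ← Finset.mul_sum]
  have hT0 : 0 ≤ (eVariationOn g univ).toReal := ENNReal.toReal_nonneg
  have hβA := mul_le_mul_of_nonneg_left hsumA (inv_nonneg.2 hβ.le)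
  exact add_le_add (mul_le_mul_of_nonneg_left (by linarith) hP0)
    (mul_le_mul_of_nonneg_left hβA hG0)
end
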